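/- arXiv:2005.12571 — 2 statements merged into one kernel-verified Lean document; each statement's English description precedes it below -/
import Mathlib

section
/- If γ₁ and γ₂ are two disjoint simple closed curves in the open Möbius strip M, then M \ (γ₁ ∪ γ₂) is disconnected. -/
noncomputable section

/-- The unit 2-sphere in `ℝ³`. -/
abbrev Sphere2 : Set (EuclideanSpace ℝ (Fin 3)) := Metric.sphere 0 1

/-- The antipodal map on the 2-sphere. -/
def antipodal (x : Sphere2) : Sphere2 :=
  ⟨-x.1, by
    rw [mem_sphere_zero_iff_norm, norm_neg]
    exact mem_sphere_zero_iff_norm.mp x.2⟩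

/-- The real projective plane, as the quotient of the sphere by the antipodal map. -/
abbrev RealProjectivePlane : Type := Quot (fun x y : Sphere2 => y = antipodal x)

/-- The covering projection from the sphere to the projective plane. -/
def sphereProj : Sphere2 → RealProjectivePlane := Quot.mk _

/-- The unit circle in the plane. -/
abbrev Circle2 : Set (EuclideanSpace ℝ (Fin 2)) := Metric.sphere 0 1

/-- The open unit disk in the plane. -/
abbrev OpenDisk : Set (EuclideanSpace ℝ (Fin 2)) := Metric.ball 0 1

/-- An open annulus in the plane. -/
abbrev OpenAnnulus : Set (EuclideanSpace ℝ (Fin 2)) := {x | ‖x‖ ∈ Set.Ioo (1:ℝ) 2}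

/-- A set is a simple closed curve if it is homeomorphic to the circle. -/
def IsSimpleClosedCurve {X : Type*} [TopologicalSpace X] (C : Set X) : Prop :=
  Nonempty (C ≃ₜ Circle2)

/-- The strip `ℝ × (-1,1)`. -/
abbrev MobiusDom : Type := {p : ℝ × ℝ // p.2 ∈ Set.Ioo (-1:ℝ) 1}

/-- The generating relation `(x, y) ∼ (x + 1, -y)` for the open Möbius strip. -/
def mobiusRel (p q : MobiusDom) : Prop := q.1.1 = p.1.1 + 1 ∧ q.1.2 = -p.1.2

/-- The open Möbius strip: the quotient of `ℝ × (-1,1)` by `(x,y) ∼ (x+1,-y)`. -/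
abbrev OpenMobius : Type := Quot mobiusRel

/-- The generating relation `(x, y) ∼ (x + 2, y)` for the open cylinder. -/
def cylinderRel (p q : MobiusDom) : Prop := q.1.1 = p.1.1 + 2 ∧ q.1.2 = p.1.2

/-- The open cylinder: the quotient of `ℝ × (-1,1)` by `(x,y) ∼ (x+2,y)`. -/
abbrev OpenCylinder : Type := Quot cylinderRel

/-- The orientation double covering of the open Möbius strip by the open cylinder. -/
def mobiusCover : OpenCylinder → OpenMobius :=
  Quot.lift (fun p => Quot.mk mobiusRel p) (by
    rintro p q ⟨h1, h2⟩
    have hmid : (-p.1.2) ∈ Set.Ioo (-1:ℝ) 1 := by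
      obtain ⟨ha, hb⟩ := p.2; constructor <;> linarith
    have s1 : Quot.mk mobiusRel p = Quot.mk mobiusRel ⟨(p.1.1 + 1, -p.1.2), hmid⟩ :=
      Quot.sound ⟨rfl, rfl⟩
    have s2 : Quot.mk mobiusRel ⟨(p.1.1 + 1, -p.1.2), hmid⟩ = Quot.mk mobiusRel q := by
      apply Quot.sound
      constructor
      · simpa [h1] using by ring
      · simp [h2]
    exact s1.trans s2)

/-- The nontrivial deck transformation of the covering `mobiusCover`,
induced by `(x, y) ↦ (x + 1, -y)`. -/
def mobiusDeck : OpenCylinder → OpenCylinder :=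
  Quot.lift
    (fun p => Quot.mk cylinderRel
      ⟨(p.1.1 + 1, -p.1.2), by obtain ⟨ha, hb⟩ := p.2; constructor <;> dsimp <;> linarith⟩)
    (by
      rintro p q ⟨h1, h2⟩
      apply Quot.sound
      constructor
      · simpa [h1] using by ring
      · simp [h2])

/-- A 2-manifold (an open subset of a surface) is *orientable* if it contains no
homeomorphic copy of the open Möbius strip. -/
def Orientable (X : Type*) [TopologicalSpace X] : Prop :=
  ¬ ∃ A : Set X, Nonempty (A ≃ₜ OpenMobius)

end

open Set Topology Complex unitInterval in
/-- A nonvanishing homotopy `H` of complex functions yields a square root of the product of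
its two ends. -/
theorem exists_continuous_sqrt_of_homotopy {X : Type*} [TopologicalSpace X] (H : I × X → ℂ)
    (hH : Continuous H) (h0 : ∀ p, H p ≠ 0) :
    ∃ s : X → ℂ, Continuous s ∧ ∀ x, s x ^ 2 = H (0, x) * H (1, x) := by
  let K : C(I × X, {z : ℂ // z ≠ 0}) :=
    ⟨fun p => ⟨H p / H (0, p.2), div_ne_zero (h0 _) (h0 _)⟩, by
      refine Continuous.subtype_mk (hH.div ?_ fun p => h0 _) _
      exact hH.comp (continuous_const.prodMk continuous_snd)⟩
  have hK0 : ∀ x, K (0, x) = ⟨cexp ((0 : C(X, ℂ)) x), exp_ne_zero _⟩ := by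
    intro x
    apply Subtype.ext
    simp [K, h0]
  let L := isCoveringMap_exp.liftHomotopy K (0 : C(X, ℂ)) hK0
  have hL : ∀ x, cexp (L (1, x)) = H (1, x) / H (0, x) := fun x =>
    congrArg Subtype.val (congrFun (isCoveringMap_exp.liftHomotopy_lifts K (0 : C(X, ℂ)) hK0) (1, x))
  refine ⟨fun x => H (0, x) * cexp (L (1, x) / 2), ?_, fun x => ?_⟩
  · have h1 : Continuous fun x => L (1, x) := L.continuous.comp (by fun_prop)
    have h2 : Continuous fun x => H (0, x) := hH.comp (by fun_prop)
    fun_prop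
  · have : cexp (L (1, x) / 2) ^ 2 = cexp (L (1, x)) := by
      rw [← Complex.exp_nat_mul]; congr 1; push_cast; ring
    rw [mul_pow, this, hL]
    field_simp [h0]

open Set Topology Complex unitInterval in
/-- A nonvanishing continuous complex function on the real line has a continuous square root. -/
theorem exists_continuous_sqrt_real (f : ℝ → ℂ) (hf : Continuous f) (h0 : ∀ t, f t ≠ 0) :
    ∃ s : ℝ → ℂ, Continuous s ∧ ∀ t, s t ^ 2 = f t := by
  obtain ⟨s, hs, h⟩ := exists_continuous_sqrt_of_homotopy
    (fun p : I × ℝ => f (p.1 * p.2) / f 0)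
    ((hf.comp (by fun_prop)).div_const _) (fun p => div_ne_zero (h0 _) (h0 _))
  obtain ⟨c, hc⟩ := IsAlgClosed.exists_pow_nat_eq (f 0) (n := 2) two_pos
  refine ⟨fun t => c * s t, by fun_prop, fun t => ?_⟩
  rw [mul_pow, h, hc]
  have := h0 0
  simp
  field_simp

open Set Topology Complex in
/-- A function with a simple zero has no continuous square root around that zero. -/
theorem not_exists_sqrt_near_simple_zero {z₀ : ℂ} {u s : ℂ → ℂ} {r : ℝ} (hr : 0 < r)
    (hu : Continuous u) (hu0 : u z₀ ≠ 0)
    (hs : ContinuousOn s (Metric.ball z₀ r \ {z₀}))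
    (h : ∀ z ∈ Metric.ball z₀ r \ {z₀}, s z ^ 2 = (z - z₀) * u z) : False := by
  obtain ⟨δ, hδ, hball⟩ := Metric.continuous_iff.1 (hu.div_const (u z₀)) z₀ 1 one_pos
  set ρ : ℝ := min δ r / 2 with hρ
  have hm : 0 < min δ r := lt_min hδ hr
  have hρ0 : 0 < ρ := by positivity
  have hdist : ∀ θ, dist (circleMap z₀ ρ θ) z₀ = ρ := fun θ => by
    simp [circleMap, dist_eq_norm, abs_of_pos hρ0]
  have hmem : ∀ θ, circleMap z₀ ρ θ ∈ Metric.ball z₀ r \ {z₀} := fun θ =>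
    ⟨by rw [Metric.mem_ball, hdist]; linarith [min_le_right δ r],
      circleMap_ne_center hρ0.ne'⟩
  have hslit : ∀ θ, u (circleMap z₀ ρ θ) / u z₀ ∈ slitPlane := fun θ => by
    apply ball_one_subset_slitPlane
    have := hball (circleMap z₀ ρ θ) (by rw [hdist]; linarith [min_le_left δ r])
    rwa [div_self hu0] at this
  obtain ⟨κ, hκ⟩ := IsAlgClosed.exists_pow_nat_eq (ρ * u z₀) (n := 2) two_pos
  have hκ0 : κ ≠ 0 := by
    rintro rfl
    have : (ρ : ℂ) ≠ 0 := by exact_mod_cast hρ0.ne'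
    exact mul_ne_zero this hu0 (by rw [← hκ]; simp)
  let a : ℝ → ℂ := fun θ => s (circleMap z₀ ρ θ)
  let b : ℝ → ℂ := fun θ =>
    κ * cexp (θ * I / 2) * cexp (log (u (circleMap z₀ ρ θ) / u z₀) / 2)
  have ha : Continuous a := hs.comp_continuous (continuous_circleMap _ _) hmem
  have hb : Continuous b := by
    have : Continuous fun θ => log (u (circleMap z₀ ρ θ) / u z₀) :=
      Continuous.clog ((hu.comp (continuous_circleMap _ _)).div_const _) hslit
    fun_prop
  have hb0 : ∀ θ, b θ ≠ 0 := fun θ =>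
    mul_ne_zero (mul_ne_zero hκ0 (exp_ne_zero _)) (exp_ne_zero _)
  have hsq : ∀ θ, a θ ^ 2 = b θ ^ 2 := fun θ => by
    simp only [a, b]
    rw [h _ (hmem θ), mul_pow, mul_pow, hκ, ← Complex.exp_nat_mul, ← Complex.exp_nat_mul]
    have e1 : ((2 : ℕ) : ℂ) * (log (u (circleMap z₀ ρ θ) / u z₀) / 2)
      = log (u (circleMap z₀ ρ θ) / u z₀) := by push_cast; ring
    have e2 : ((2 : ℕ) : ℂ) * (θ * I / 2) = θ * I := by push_cast; ring
    rw [e1, e2, Complex.exp_log (slitPlane_ne_zero (hslit θ))]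
    simp only [circleMap]
    field_simp
    ring
  have ha2 : a (2 * Real.pi) = a 0 := by
    simp only [a]
    congr 1
    simpa using periodic_circleMap z₀ ρ 0
  have hb2 : b (2 * Real.pi) = - b 0 := by
    have hc : circleMap z₀ ρ (2 * Real.pi) = circleMap z₀ ρ 0 := by
      simpa using periodic_circleMap z₀ ρ 0
    have e : ((2 * Real.pi : ℝ) : ℂ) * I / 2 = Real.pi * I := by push_cast; ring
    simp only [b]
    rw [hc, e, exp_pi_mul_I]
    simp
  have hfin : b 0 = - b 0 := by
    rcases isPreconnected_univ.eq_or_eq_neg_of_sq_eq ha.continuousOn hb.continuousOn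
      (fun θ _ => hsq θ) (fun {θ} _ => hb0 θ) with e | e
    · rw [← hb2, ← e (mem_univ _), ← e (mem_univ _), ha2]
    · have e0 := e (mem_univ 0)
      have e1 := e (mem_univ (2 * Real.pi))
      rw [Pi.neg_apply] at e0 e1
      rw [hb2, ha2, e0] at e1
      rw [neg_neg] at e1
      exact e1.symm
  exact hb0 0 (self_eq_neg.1 hfin)

/-- The function `f` has a continuous square root on the set `U`. -/
def HasSqrtOn {X : Type*} [TopologicalSpace X] (f : X → ℂ) (U : Set X) : Prop :=
  ∃ s : X → ℂ, ContinuousOn s U ∧ ∀ x ∈ U, s x ^ 2 = f x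

namespace HasSqrtOn

variable {X : Type*} [TopologicalSpace X] {f g : X → ℂ} {U V : Set X}

theorem mono (h : HasSqrtOn f U) (hVU : V ⊆ U) : HasSqrtOn f V := by
  obtain ⟨s, hs, h⟩ := h
  exact ⟨s, hs.mono hVU, fun x hx => h x (hVU hx)⟩

theorem mul (hf : HasSqrtOn f U) (hg : HasSqrtOn g U) : HasSqrtOn (fun x => f x * g x) U := by
  obtain ⟨s, hs, h⟩ := hf
  obtain ⟨t, ht, h'⟩ := hg
  exact ⟨fun x => s x * t x, hs.mul ht, fun x hx => by
    change (s x * t x) ^ 2 = _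
    rw [mul_pow, h x hx, h' x hx]⟩

theorem of_sq_mul {k : X → ℂ} (hk : ContinuousOn k U) (hk0 : ∀ x ∈ U, k x ≠ 0)
    (h : HasSqrtOn g U) (hfg : ∀ x ∈ U, k x ^ 2 * f x = g x) : HasSqrtOn f U := by
  obtain ⟨s, hs, h⟩ := h
  refine ⟨fun x => s x / k x, hs.div hk hk0, fun x hx => ?_⟩
  have := hk0 x hx
  rw [div_pow, h x hx, ← hfg x hx]
  field_simp

open Set in
/-- Square roots on two open sets with preconnected intersection glue to a square root on the
union. -/
theorem union (hU : IsOpen U) (hV : IsOpen V) (hUV : IsPreconnected (U ∩ V))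
    (h0 : ∀ x ∈ U ∩ V, f x ≠ 0) (hfU : HasSqrtOn f U) (hfV : HasSqrtOn f V) :
    HasSqrtOn f (U ∪ V) := by
  classical
  obtain ⟨s, hs, hs2⟩ := hfU
  obtain ⟨t, ht, ht2⟩ := hfV
  obtain ⟨t', ht', ht2', heq⟩ : ∃ t' : X → ℂ, ContinuousOn t' V ∧ (∀ x ∈ V, t' x ^ 2 = f x) ∧
      EqOn s t' (U ∩ V) := by
    rcases hUV.eq_or_eq_neg_of_sq_eq (hs.mono inter_subset_left) (ht.mono inter_subset_right)
      (fun x hx => by simp [hs2 x hx.1, ht2 x hx.2])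
      (fun {x} hx hx0 => h0 x hx (by rw [← ht2 x hx.2, hx0]; simp)) with e | e
    · exact ⟨t, ht, ht2, e⟩
    · exact ⟨-t, ht.neg, fun x hx => by simp [ht2 x hx], e⟩
  refine ⟨U.piecewise s t', ?_, ?_⟩
  · refine ContinuousOn.union_of_isOpen ?_ ?_ hU hV
    · exact hs.congr fun x hx => by simp [hx]
    · refine ht'.congr fun x hx => ?_
      by_cases hxU : x ∈ U
      · simp [hxU, heq ⟨hxU, hx⟩]
      · simp [hxU]
  · rintro x hx
    by_cases hxU : x ∈ U
    · simp [hxU, hs2]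
    · simp [hxU, ht2' x (hx.resolve_left hxU)]

open unitInterval in
theorem of_homotopy (H : I × X → ℂ) (hH : Continuous H) (h0 : ∀ t, ∀ x ∈ U, H (t, x) ≠ 0) :
    HasSqrtOn (fun x => H (0, x) * H (1, x)) U := by
  classical
  obtain ⟨s, hs, h⟩ := exists_continuous_sqrt_of_homotopy
    (fun p : I × U => H (p.1, p.2)) (hH.comp (by fun_prop)) (fun p => h0 _ _ p.2.2)
  refine ⟨fun x => if hx : x ∈ U then s ⟨x, hx⟩ else 0, ?_, fun x hx => ?_⟩
  · rw [continuousOn_iff_continuous_domRestrict]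
    convert hs with x
    simp
  · simpa [hx] using h ⟨x, hx⟩

end HasSqrtOn

/-- A simple closed curve is parametrized by a loop which splits it into two arcs meeting at two
distinct points. -/
theorem IsSimpleClosedCurve.exists_parametrization {X : Type*} [TopologicalSpace X] {C : Set X}
    (hC : IsSimpleClosedCurve C) :
    ∃ a : ℝ → X, Continuous a ∧ a 2 = a 0 ∧ a 0 ≠ a 1 ∧ (∀ t, a t ∈ C) ∧
      C ⊆ a '' Set.Icc 0 1 ∪ a '' Set.Icc 1 2 ∧
      a '' Set.Icc 0 1 ∩ a '' Set.Icc 1 2 ⊆ {a 0, a 1} := by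
  obtain ⟨e⟩ := hC
  have hmem : ∀ x y : ℝ, x ^ 2 + y ^ 2 = 1 → !₂[x, y] ∈ Circle2 := fun x y h => by
    rw [mem_sphere_zero_iff_norm, EuclideanSpace.norm_eq]
    simp [Fin.sum_univ_two, h]
  let c : ℝ → Circle2 := fun t => ⟨!₂[Real.cos (Real.pi * t), Real.sin (Real.pi * t)],
    hmem _ _ (Real.cos_sq_add_sin_sq _)⟩
  have hc : Continuous c := by
    refine Continuous.subtype_mk ?_ _
    refine (PiLp.continuous_toLp 2 _).comp (continuous_pi fun i => ?_)
    fin_cases i <;> simp <;> fun_prop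
  have hcos : ∀ {s t}, c s = c t → Real.cos (Real.pi * s) = Real.cos (Real.pi * t) :=
    fun {s t} h => congrArg (fun v : Circle2 => v.1 0) h
  have hsin : ∀ {s t}, c s = c t → Real.sin (Real.pi * s) = Real.sin (Real.pi * t) :=
    fun {s t} h => congrArg (fun v : Circle2 => v.1 1) h
  have hinj : ∀ {s t}, ((e.symm (c s) : C) : X) = e.symm (c t) → c s = c t :=
    fun {s t} h => e.symm.injective (Subtype.ext h)
  have hpi := Real.pi_pos
  refine ⟨fun t => (e.symm (c t) : C), by fun_prop, ?_, ?_, fun t => (e.symm (c t)).2, ?_, ?_⟩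
  · have : c 2 = c 0 := by
      apply Subtype.ext
      simp [c, mul_comm Real.pi 2]
    simp only [this]
  · intro h
    have := hcos (hinj h)
    norm_num at this
  · intro x hx
    set v := e ⟨x, hx⟩ with hv
    have hn : v.1 0 ^ 2 + v.1 1 ^ 2 = 1 := by
      have := mem_sphere_zero_iff_norm.1 v.2
      rw [EuclideanSpace.norm_eq, Real.sqrt_eq_one] at this
      simpa [Fin.sum_univ_two] using this
    have key : ∀ t, Real.cos (Real.pi * t) = v.1 0 → Real.sin (Real.pi * t) = v.1 1 →
        ((e.symm (c t) : C) : X) = x := fun t h1 h2 => by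
      have : c t = v := by
        apply Subtype.ext
        ext i
        fin_cases i <;> simp [c, h1, h2]
      rw [this, hv, e.symm_apply_apply]
    have hb0 : -1 ≤ v.1 0 := by nlinarith [sq_nonneg (v.1 1)]
    have hb1 : v.1 0 ≤ 1 := by nlinarith [sq_nonneg (v.1 1)]
    have hs : Real.sin (Real.arccos (v.1 0)) = |v.1 1| := by
      rw [Real.sin_arccos, ← Real.sqrt_sq_eq_abs]
      congr 1
      linarith
    have h0 := Real.arccos_nonneg (v.1 0)
    have h1 := Real.arccos_le_pi (v.1 0)
    rcases le_total 0 (v.1 1) with hy | hy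
    · left
      refine ⟨Real.arccos (v.1 0) / Real.pi, ⟨by positivity, by rwa [div_le_one hpi]⟩, ?_⟩
      have e1 : Real.pi * (Real.arccos (v.1 0) / Real.pi) = Real.arccos (v.1 0) := by field_simp
      exact key _ (by rw [e1, Real.cos_arccos hb0 hb1]) (by rw [e1, hs, abs_of_nonneg hy])
    · right
      have h2 : Real.arccos (v.1 0) / Real.pi ≤ 1 := by rwa [div_le_one hpi]
      have h3 : 0 ≤ Real.arccos (v.1 0) / Real.pi := by positivity
      refine ⟨2 - Real.arccos (v.1 0) / Real.pi, ⟨by linarith, by linarith⟩, ?_⟩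
      have e1 : Real.pi * (2 - Real.arccos (v.1 0) / Real.pi)
        = 2 * Real.pi - Real.arccos (v.1 0) := by field_simp
      exact key _ (by rw [e1, Real.cos_two_pi_sub, Real.cos_arccos hb0 hb1])
        (by rw [e1, Real.sin_two_pi_sub, hs, abs_of_nonpos hy, neg_neg])
  · rintro x ⟨⟨s, hs, rfl⟩, ⟨t, ht, hst⟩⟩
    have h := hinj hst
    have h1 : 0 ≤ Real.sin (Real.pi * s) :=
      Real.sin_nonneg_of_nonneg_of_le_pi (by nlinarith [hs.1]) (by nlinarith [hs.2])
    have h2 : 0 ≤ Real.sin (Real.pi * (t - 1)) :=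
      Real.sin_nonneg_of_nonneg_of_le_pi (by nlinarith [ht.1]) (by nlinarith [ht.2])
    have h3 : Real.sin (Real.pi * (t - 1)) = - Real.sin (Real.pi * t) := by
      rw [mul_sub, mul_one, Real.sin_sub_pi]
    have h4 : Real.sin (Real.pi * s) = 0 := by
      have := hsin h
      linarith
    rcases hs.1.eq_or_lt with h0 | h0
    · left; rw [← h0]
    rcases hs.2.eq_or_lt with h5 | h5
    · right; rw [h5]; rfl
    exact absurd h4 (Real.sin_pos_of_pos_of_lt_pi (by positivity) (by nlinarith)).ne'

section MobiusInvariants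

open Complex ComplexConjugate

/-- The function `(x, y) ↦ exp (2πix)` on the Möbius strip. -/
noncomputable def mobiusAngle : OpenMobius → ℂ :=
  Quot.lift (fun p => cexp (Real.pi * I * p.1.1) ^ 2) (by
    rintro p q ⟨h, -⟩
    simp only [h]
    push_cast
    rw [mul_add, mul_one, Complex.exp_add, exp_pi_mul_I]
    ring)

/-- The function `(x, y) ↦ exp (πix) (exp (-πy) - exp (πy))` on the Möbius strip. -/
noncomputable def mobiusTrace : OpenMobius → ℂ :=
  Quot.lift (fun p => cexp (Real.pi * I * p.1.1) *
      ((Real.exp (-(Real.pi * p.1.2)) - Real.exp (Real.pi * p.1.2) : ℝ) : ℂ)) (by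
    rintro p q ⟨h, h'⟩
    simp only [h, h']
    push_cast
    rw [mul_add, mul_one, Complex.exp_add, exp_pi_mul_I]
    ring_nf)

/-- The polynomial in `ω` whose two roots are the points of the annulus lying over `m`, for the
double cover of the Möbius strip by the annulus with deck transformation `ζ ↦ -1 / conj ζ`. -/
noncomputable def mobiusPoly (ω : ℂ) (m : OpenMobius) : ℂ :=
  ω ^ 2 - mobiusTrace m * ω - mobiusAngle m

theorem continuous_mobiusAngle : Continuous mobiusAngle :=
  continuous_quot_lift _ (by fun_prop)

theorem continuous_mobiusTrace : Continuous mobiusTrace :=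
  continuous_quot_lift _ (by fun_prop)

theorem continuous_mobiusPoly (ω : ℂ) : Continuous (mobiusPoly ω) := by
  have h1 := continuous_mobiusAngle
  have h2 := continuous_mobiusTrace
  unfold mobiusPoly
  fun_prop

theorem mobiusAngle_ne_zero (m : OpenMobius) : mobiusAngle m ≠ 0 := by
  induction m using Quot.ind with
  | mk p => exact pow_ne_zero 2 (exp_ne_zero _)

theorem conj_exp_pi_mul_I (x : ℝ) :
    conj (cexp (Real.pi * I * x)) * cexp (Real.pi * I * x) = 1 := by
  rw [← exp_conj, ← Complex.exp_add, ← Complex.exp_zero]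
  congr 1
  simp

theorem conj_mobiusAngle_mul (m : OpenMobius) : conj (mobiusAngle m) * mobiusAngle m = 1 := by
  induction m using Quot.ind with
  | mk p =>
    simp only [mobiusAngle, map_pow]
    rw [← mul_pow, conj_exp_pi_mul_I, one_pow]

theorem conj_mobiusTrace_mul (m : OpenMobius) :
    conj (mobiusTrace m) * mobiusAngle m = mobiusTrace m := by
  induction m using Quot.ind with
  | mk p =>
    simp only [mobiusAngle, mobiusTrace, map_mul, conj_ofReal]
    linear_combination (cexp (Real.pi * I * p.1.1) *
      ((Real.exp (-(Real.pi * p.1.2)) - Real.exp (Real.pi * p.1.2) : ℝ) : ℂ)) *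
      conj_exp_pi_mul_I p.1.1

theorem mobiusDiscriminant_ne_zero (m : OpenMobius) :
    mobiusTrace m ^ 2 + 4 * mobiusAngle m ≠ 0 := by
  induction m using Quot.ind with
  | mk p =>
    have h : Real.exp (-(Real.pi * p.1.2)) * Real.exp (Real.pi * p.1.2) = 1 := by
      rw [← Real.exp_add]; simp
    have h' : mobiusTrace (Quot.mk _ p) ^ 2 + 4 * mobiusAngle (Quot.mk _ p) =
        (cexp (Real.pi * I * p.1.1) *
          ((Real.exp (-(Real.pi * p.1.2)) + Real.exp (Real.pi * p.1.2) : ℝ) : ℂ)) ^ 2 := by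
      have h2 : (Real.exp (-(Real.pi * p.1.2)) : ℂ) * Real.exp (Real.pi * p.1.2) = 1 := by
        exact_mod_cast h
      simp only [mobiusAngle, mobiusTrace, ofReal_add, ofReal_sub]
      linear_combination (-4) * cexp (Real.pi * I * p.1.1) ^ 2 * h2
    rw [h']
    refine pow_ne_zero 2 (mul_ne_zero (exp_ne_zero _) ?_)
    have := add_pos (Real.exp_pos (-(Real.pi * p.1.2))) (Real.exp_pos (Real.pi * p.1.2))
    exact_mod_cast ne_of_gt this

/-- Every point of the strip is equivalent to a point with any prescribed integer translate of
its first coordinate. -/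
theorem exists_mobius_translate (p : MobiusDom) (n : ℤ) :
    ∃ q : MobiusDom, Quot.mk mobiusRel q = Quot.mk mobiusRel p ∧ q.1.1 = p.1.1 + n := by
  have hneg : ∀ q : MobiusDom, -q.1.2 ∈ Set.Ioo (-1 : ℝ) 1 := fun q =>
    ⟨by linarith [q.2.2], by linarith [q.2.1]⟩
  induction n using Int.induction_on with
  | zero => exact ⟨p, rfl, by simp⟩
  | succ n ih =>
    obtain ⟨q, hq, hx⟩ := ih
    refine ⟨⟨(q.1.1 + 1, -q.1.2), hneg q⟩, ?_, ?_⟩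
    · rw [← hq]
      exact (Quot.sound ⟨rfl, rfl⟩).symm
    · simp [hx, add_assoc]
  | pred n ih =>
    obtain ⟨q, hq, hx⟩ := ih
    refine ⟨⟨(q.1.1 - 1, -q.1.2), hneg q⟩, ?_, ?_⟩
    · rw [← hq]
      exact Quot.sound ⟨by simp, by simp⟩
    · push_cast at hx ⊢
      rw [hx]
      ring

theorem eq_of_mobiusAngle_eq_of_mobiusTrace_eq {m m' : OpenMobius}
    (hA : mobiusAngle m = mobiusAngle m') (hT : mobiusTrace m = mobiusTrace m') : m = m' := by
  induction m using Quot.ind with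
  | mk p =>
  induction m' using Quot.ind with
  | mk p' =>
    obtain ⟨n, hn⟩ : ∃ n : ℤ, p.1.1 = p'.1.1 + n := by
      simp only [mobiusAngle, ← Complex.exp_nat_mul] at hA
      obtain ⟨n, hn⟩ := exp_eq_exp_iff_exists_int.1 hA
      refine ⟨n, ?_⟩
      have h1 : (2 * Real.pi * I : ℂ) * p.1.1 = (2 * Real.pi * I : ℂ) * (p'.1.1 + n) := by
        push_cast at hn
        linear_combination hn
      have h2 := mul_left_cancel₀ two_pi_I_ne_zero h1
      exact_mod_cast h2
    obtain ⟨q, hq, hx⟩ := exists_mobius_translate p' n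
    rw [← hq] at hT ⊢
    have hpq : p.1.1 = q.1.1 := by rw [hn, hx]
    congr 1
    apply Subtype.ext
    refine Prod.ext hpq ?_
    simp only [mobiusTrace, hpq] at hT
    have h := mul_left_cancel₀ (exp_ne_zero _) hT
    have h' : Real.exp (-(Real.pi * p.1.2)) - Real.exp (Real.pi * p.1.2) =
      Real.exp (-(Real.pi * q.1.2)) - Real.exp (Real.pi * q.1.2) := by exact_mod_cast h
    have hpi := Real.pi_pos
    have key : ∀ {a b : ℝ}, a < b → Real.exp (-(Real.pi * b)) - Real.exp (Real.pi * b) <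
        Real.exp (-(Real.pi * a)) - Real.exp (Real.pi * a) := fun {a b} hab => by
      have h1 : Real.pi * a < Real.pi * b := by gcongr
      linarith [Real.exp_lt_exp.2 h1, Real.exp_lt_exp.2 (neg_lt_neg h1)]
    rcases lt_trichotomy p.1.2 q.1.2 with hlt | heq | hlt
    · exact absurd h' (key hlt).ne'
    · exact heq
    · exact absurd h' (key hlt).ne

theorem ne_zero_of_mobiusPoly_eq_zero {ω : ℂ} {m : OpenMobius} (h : mobiusPoly ω m = 0) :
    ω ≠ 0 := by
  rintro rfl
  simp [mobiusPoly] at h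
  exact mobiusAngle_ne_zero m h

/-- The values of `mobiusPoly` at `ω` and at its image under the deck transformation. -/
theorem mobiusPoly_deck {ω : ℂ} (hω : ω ≠ 0) (m : OpenMobius) :
    conj ω ^ 2 * mobiusPoly (-(conj ω)⁻¹) m = -mobiusAngle m * conj (mobiusPoly ω m) := by
  have h : conj ω ≠ 0 := (map_ne_zero _).2 hω
  simp only [mobiusPoly, map_sub, map_mul, map_pow]
  field_simp
  linear_combination (-1 : ℂ) * conj_mobiusAngle_mul m - conj ω * conj_mobiusTrace_mul m

theorem conj_mul_self_ne_neg_one (ω : ℂ) : conj ω * ω ≠ -1 := by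
  intro h
  have h' := congrArg Complex.re h
  rw [mul_comm, mul_conj, ofReal_re] at h'
  have := normSq_nonneg ω
  norm_num at h'
  linarith

theorem root_add_deck_eq_mobiusTrace {ω : ℂ} {m : OpenMobius} (h : mobiusPoly ω m = 0) :
    ω - (conj ω)⁻¹ = mobiusTrace m := by
  have hω := ne_zero_of_mobiusPoly_eq_zero h
  have hc : conj ω ≠ 0 := (map_ne_zero _).2 hω
  have h2 : mobiusPoly (-(conj ω)⁻¹) m = 0 := by
    have := mobiusPoly_deck hω m
    rw [h, map_zero, mul_zero] at this
    exact (mul_eq_zero.1 this).resolve_left (pow_ne_zero 2 hc)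
  have h3 : ω + (conj ω)⁻¹ ≠ 0 := by
    intro h3
    apply conj_mul_self_ne_neg_one ω
    field_simp at h3
    linear_combination h3
  have h4 : (ω + (conj ω)⁻¹) * (ω - (conj ω)⁻¹ - mobiusTrace m) = 0 := by
    simp only [mobiusPoly] at h h2
    linear_combination h - h2
  exact sub_eq_zero.1 ((mul_eq_zero.1 h4).resolve_left h3)

theorem eq_of_mobiusPoly_eq_zero {ω : ℂ} {m m' : OpenMobius} (h : mobiusPoly ω m = 0)
    (h' : mobiusPoly ω m' = 0) : m = m' := by
  have hT : mobiusTrace m = mobiusTrace m' :=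
    (root_add_deck_eq_mobiusTrace h).symm.trans (root_add_deck_eq_mobiusTrace h')
  refine eq_of_mobiusAngle_eq_of_mobiusTrace_eq ?_ hT
  simp only [mobiusPoly, hT] at h h'
  linear_combination h' - h

theorem eq_or_eq_deck_of_mobiusPoly_eq_zero {ω ω' : ℂ} {m : OpenMobius}
    (h : mobiusPoly ω m = 0) (h' : mobiusPoly ω' m = 0) : ω' = ω ∨ ω' = -(conj ω)⁻¹ := by
  have hT := root_add_deck_eq_mobiusTrace h
  have : (ω' - ω) * (ω' + (conj ω)⁻¹) = 0 := by
    simp only [mobiusPoly, ← hT] at h h'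
    linear_combination h' - h
  rcases mul_eq_zero.1 this with h1 | h1
  · exact Or.inl (sub_eq_zero.1 h1)
  · exact Or.inr (eq_neg_of_add_eq_zero_left h1)

/-- Lines in the Möbius strip lift to its double cover. -/
theorem exists_continuous_root (a : ℝ → OpenMobius) (ha : Continuous a) :
    ∃ ω : ℝ → ℂ, Continuous ω ∧ ∀ t, mobiusPoly (ω t) (a t) = 0 := by
  have h1 := continuous_mobiusAngle.comp ha
  have h2 := continuous_mobiusTrace.comp ha
  obtain ⟨d, hd, h⟩ := exists_continuous_sqrt_real
    (fun t => mobiusTrace (a t) ^ 2 + 4 * mobiusAngle (a t))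
    ((h2.pow 2).add (continuous_const.mul h1)) (fun t => mobiusDiscriminant_ne_zero _)
  refine ⟨fun t => (mobiusTrace (a t) + d t) / 2, (h2.add hd).div_const _, fun t => ?_⟩
  simp only [mobiusPoly]
  linear_combination h t / 4

instance : T2Space OpenMobius :=
  T2Space.of_injective_continuous (f := fun m => (mobiusAngle m, mobiusTrace m))
    (fun _ _ h => eq_of_mobiusAngle_eq_of_mobiusTrace_eq (congrArg Prod.fst h)
      (congrArg Prod.snd h))
    (continuous_mobiusAngle.prodMk continuous_mobiusTrace)

theorem mobiusPoly_mk (ω : ℂ) (p : MobiusDom) :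
    mobiusPoly ω (Quot.mk _ p) = (ω - cexp (Real.pi * I * (p.1.1 + p.1.2 * I))) *
      (ω + cexp (Real.pi * I * (p.1.1 - p.1.2 * I))) := by
  have e1 : cexp (Real.pi * I * (p.1.1 + p.1.2 * I)) =
      cexp (Real.pi * I * p.1.1) * cexp (-(Real.pi * p.1.2)) := by
    rw [← Complex.exp_add]; congr 1
    linear_combination (Real.pi * p.1.2 : ℂ) * I_mul_I
  have e2 : cexp (Real.pi * I * (p.1.1 - p.1.2 * I)) =
      cexp (Real.pi * I * p.1.1) * cexp (Real.pi * p.1.2) := by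
    rw [← Complex.exp_add]; congr 1
    linear_combination (-Real.pi * p.1.2 : ℂ) * I_mul_I
  have e3 : cexp (-(Real.pi * p.1.2)) * cexp (Real.pi * p.1.2) = 1 := by
    rw [← Complex.exp_add]; simp
  simp only [mobiusPoly, mobiusAngle, mobiusTrace]
  rw [e1, e2]
  push_cast
  linear_combination cexp (Real.pi * I * p.1.1) ^ 2 * e3

theorem exists_rep_of_mobiusPoly_eq_zero {ω : ℂ} {m : OpenMobius} (h : mobiusPoly ω m = 0) :
    ∃ p : MobiusDom, Quot.mk mobiusRel p = m ∧
      ω = cexp (Real.pi * I * (p.1.1 + p.1.2 * I)) := by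
  induction m using Quot.ind with
  | mk p =>
    rw [mobiusPoly_mk] at h
    rcases mul_eq_zero.1 h with h | h
    · exact ⟨p, rfl, sub_eq_zero.1 h⟩
    · refine ⟨⟨(p.1.1 + 1, -p.1.2), by linarith [p.2.2], by linarith [p.2.1]⟩,
        (Quot.sound ⟨rfl, rfl⟩).symm, ?_⟩
      rw [eq_neg_of_add_eq_zero_left h]
      push_cast
      have : (Real.pi * I * (p.1.1 + 1 + -p.1.2 * I) : ℂ) =
        Real.pi * I * (p.1.1 - p.1.2 * I) + Real.pi * I := by ring
      rw [this, Complex.exp_add, exp_pi_mul_I]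
      ring

/-- The function `mobiusPoly ω` has a simple zero, so no square root around its zero. -/
theorem not_hasSqrtOn_mobiusPoly_mul {ω : ℂ} {m : OpenMobius} (h : mobiusPoly ω m = 0)
    {k : OpenMobius → ℂ} (hk : Continuous k) (hkm : k m ≠ 0) :
    ¬ HasSqrtOn (fun x => mobiusPoly ω x * k x) {x | mobiusPoly ω x * k x ≠ 0} := by
  rintro ⟨s, hs, hs2⟩
  obtain ⟨p, rfl, hω⟩ := exists_rep_of_mobiusPoly_eq_zero h
  obtain ⟨⟨x, y⟩, hy⟩ := p
  simp only at hω hy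
  have hy1 : |y| < 1 := abs_lt.2 hy
  set b : ℝ := (1 + |y|) / 2 with hb
  have hb0 : 0 < b := by positivity
  let D : ℂ → OpenMobius := fun z => Quot.mk mobiusRel ⟨(z.re, max (-b) (min b z.im)),
    lt_of_lt_of_le (by linarith) (le_max_left _ _),
    max_lt (by linarith) (lt_of_le_of_lt (min_le_left _ _) (by linarith))⟩
  have hD : Continuous D := continuous_quot_mk.comp (Continuous.subtype_mk (by fun_prop) _)
  set z₀ : ℂ := x + y * I with hz₀
  let E : ℂ → ℂ := fun z => cexp (Real.pi * I * z)
  let u : ℂ → ℂ := fun z =>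
    -dslope E z₀ z * (E z₀ + cexp (Real.pi * I * conj z)) * k (D z)
  have hE : Differentiable ℂ E := by fun_prop
  have hds : Continuous (dslope E z₀) := by
    rw [← continuousOn_univ, continuousOn_dslope Filter.univ_mem]
    exact ⟨hE.continuous.continuousOn, hE z₀⟩
  have hu : Continuous u := by
    have : Continuous fun z => k (D z) := hk.comp hD
    have hc : Continuous (fun z : ℂ => conj z) := continuous_conj
    fun_prop
  have hDz : ∀ z ∈ Metric.ball z₀ ((1 - |y|) / 2), ∃ hz : z.im ∈ Set.Ioo (-1 : ℝ) 1,
      D z = Quot.mk mobiusRel ⟨(z.re, z.im), hz⟩ := fun z hz => by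
    rw [Metric.mem_ball, dist_eq_norm] at hz
    have h1 : |z.im - y| < (1 - |y|) / 2 := by
      refine lt_of_le_of_lt ?_ hz
      simpa [hz₀] using abs_im_le_norm (z - z₀)
    have h2 := abs_lt.1 h1
    have h3 := neg_abs_le y
    have h4 := le_abs_self y
    refine ⟨⟨by linarith, by linarith⟩, ?_⟩
    simp only [D]
    congr
    rw [min_eq_right (by linarith), max_eq_right (by linarith)]
  have hr0 : 0 < (1 - |y|) / 2 := by linarith
  have hfac : ∀ z ∈ Metric.ball z₀ ((1 - |y|) / 2),
      mobiusPoly ω (D z) * k (D z) = (z - z₀) * u z := fun z hz => by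
    obtain ⟨hz', hDz⟩ := hDz z hz
    have e1 := sub_smul_dslope E z₀ z
    rw [smul_eq_mul] at e1
    have e2 : mobiusPoly ω (D z) = (E z₀ - E z) * (E z₀ + cexp (Real.pi * I * conj z)) := by
      have hc : conj z = z.re - z.im * I := by
        apply Complex.ext <;> simp
      rw [hDz, mobiusPoly_mk, hω, hc]
      simp only [E, re_add_im]
    rw [e2]
    simp only [u]
    linear_combination ((E z₀ + cexp (Real.pi * I * conj z)) * k (D z)) * e1
  have hD0 : D z₀ = Quot.mk mobiusRel ⟨(x, y), hy⟩ := by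
    obtain ⟨_, h⟩ := hDz z₀ (Metric.mem_ball_self hr0)
    rw [h]
    congr <;> simp [hz₀]
  have hu0 : u z₀ ≠ 0 := by
    refine mul_ne_zero (mul_ne_zero (neg_ne_zero.2 ?_) ?_) (by rwa [hD0])
    · rw [dslope_same]
      have hd : HasDerivAt E (cexp (Real.pi * I * z₀) * (Real.pi * I * 1)) z₀ :=
        ((hasDerivAt_id z₀).const_mul _).cexp
      rw [hd.deriv]
      exact mul_ne_zero (exp_ne_zero _) (by simp [Real.pi_ne_zero])
    · have hc : cexp (Real.pi * I * conj z₀) * conj (E z₀) = 1 := by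
        simp only [E]
        rw [← exp_conj, ← Complex.exp_add]
        simp
      intro h0
      have h1 : conj (E z₀) * E z₀ = -1 := by linear_combination conj (E z₀) * h0 - hc
      exact conj_mul_self_ne_neg_one _ h1
  obtain ⟨δ, hδ, hball⟩ := Metric.eventually_nhds_iff_ball.1 (hu.continuousAt.eventually_ne hu0)
  have hmem : ∀ z ∈ Metric.ball z₀ (min δ ((1 - |y|) / 2)) \ {z₀},
      D z ∈ {x | mobiusPoly ω x * k x ≠ 0} := fun z hz => by
    rw [Set.mem_ofPred_eq, hfac z (Metric.ball_subset_ball (min_le_right _ _) hz.1)]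
    exact mul_ne_zero (sub_ne_zero.2 hz.2)
      (hball z (Metric.ball_subset_ball (min_le_left _ _) hz.1))
  exact not_exists_sqrt_near_simple_zero (lt_min hδ hr0) hu hu0
    (hs.comp hD.continuousOn hmem)
    (fun z hz => (hs2 _ (hmem z hz)).trans
      (hfac z (Metric.ball_subset_ball (min_le_right _ _) hz.1)))

/-- A simple closed curve in the Möbius strip is the union of two arcs `A` and `B` with common
endpoints such that the double cover branched at these endpoints is trivial off `A`, and off `B` is
either trivial or the restriction of the orientation cover. -/
theorem IsSimpleClosedCurve.exists_arcs {γ : Set OpenMobius} (hγ : IsSimpleClosedCurve γ) :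
    ∃ (A B : Set OpenMobius) (p q : OpenMobius) (ω₀ ω₁ : ℂ), IsClosed A ∧ IsClosed B ∧
      A ∪ B = γ ∧ A ∩ B ⊆ {p, q} ∧ p ≠ q ∧ p ∈ γ ∧ q ∈ γ ∧
      mobiusPoly ω₀ p = 0 ∧ mobiusPoly ω₁ q = 0 ∧
      HasSqrtOn (fun x => mobiusPoly ω₀ x * mobiusPoly ω₁ x) Aᶜ ∧
      (HasSqrtOn (fun x => mobiusPoly ω₀ x * mobiusPoly ω₁ x) Bᶜ ∨
        HasSqrtOn (fun x => mobiusPoly ω₀ x * mobiusPoly ω₁ x * mobiusAngle x) Bᶜ) := by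
  obtain ⟨a, ha, ha2, ha01, hmem, hcover, hinter⟩ := hγ.exists_parametrization
  obtain ⟨ω, hω, hroot⟩ := exists_continuous_root a ha
  have hsq : ∀ c : ℝ, HasSqrtOn (fun x => mobiusPoly (ω c) x * mobiusPoly (ω (c + 1)) x)
      (a '' Set.Icc c (c + 1))ᶜ := fun c => by
    have h := HasSqrtOn.of_homotopy (U := (a '' Set.Icc c (c + 1))ᶜ)
      (fun p : unitInterval × OpenMobius => mobiusPoly (ω (c + p.1)) p.2) (by
        have h1 := continuous_mobiusAngle
        have h2 := continuous_mobiusTrace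
        unfold mobiusPoly
        fun_prop)
      (fun t x hx h0 => hx ⟨c + t, ⟨by linarith [t.2.1], by linarith [t.2.2]⟩,
        eq_of_mobiusPoly_eq_zero (hroot _) h0⟩)
    simpa using h
  have hA := hsq 0
  have hB := hsq 1
  rw [zero_add] at hA
  rw [one_add_one_eq_two] at hB
  refine ⟨_, _, a 0, a 1, ω 0, ω 1, (isCompact_Icc.image ha).isClosed,
    (isCompact_Icc.image ha).isClosed, ?_, hinter, ha01, hmem 0, hmem 1, hroot 0, hroot 1, hA, ?_⟩
  · refine Set.Subset.antisymm (Set.union_subset ?_ ?_) hcover <;>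
      exact Set.image_subset_iff.2 fun t _ => hmem t
  have h2 : mobiusPoly (ω 2) (a 0) = 0 := ha2 ▸ hroot 2
  rcases eq_or_eq_deck_of_mobiusPoly_eq_zero (hroot 0) h2 with h | h
  · left
    rw [h] at hB
    simpa only [mul_comm] using hB
  · right
    have hω0 : ω 0 ≠ 0 := ne_zero_of_mobiusPoly_eq_zero (hroot 0)
    have hc0 : conj (ω 0) ≠ 0 := (map_ne_zero _).2 hω0
    have hne : ∀ x ∈ (a '' Set.Icc 1 2)ᶜ, mobiusPoly (ω 0) x ≠ 0 := fun x hx h0 =>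
      hx ⟨2, ⟨by norm_num, le_rfl⟩, ha2.trans (eq_of_mobiusPoly_eq_zero (hroot 0) h0)⟩
    have hcont := continuous_mobiusPoly (ω 0)
    refine HasSqrtOn.of_sq_mul
      (k := fun x => I * conj (mobiusPoly (ω 0) x) / (‖mobiusPoly (ω 0) x‖ * conj (ω 0)))
      ?_ (fun x hx => ?_) hB (fun x hx => ?_)
    · refine ContinuousOn.div ?_ ?_ fun x hx => mul_ne_zero ?_ hc0
      · exact (continuous_const.mul (continuous_conj.comp hcont)).continuousOn
      · exact ((continuous_ofReal.comp hcont.norm).mul continuous_const).continuousOn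
      · exact_mod_cast norm_ne_zero_iff.2 (hne x hx)
    · have h1 := hne x hx
      have h3 : conj (mobiusPoly (ω 0) x) ≠ 0 := (map_ne_zero _).2 h1
      have h4 : (‖mobiusPoly (ω 0) x‖ : ℂ) ≠ 0 := by exact_mod_cast norm_ne_zero_iff.2 h1
      exact div_ne_zero (mul_ne_zero I_ne_zero h3) (mul_ne_zero h4 hc0)
    · have h1 := hne x hx
      have h3 : conj (mobiusPoly (ω 0) x) ≠ 0 := (map_ne_zero _).2 h1
      have h4 : (‖mobiusPoly (ω 0) x‖ : ℂ) ^ 2 =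
        mobiusPoly (ω 0) x * conj (mobiusPoly (ω 0) x) := by
        rw [mul_conj, normSq_eq_norm_sq]; push_cast; rfl
      have h5 := mobiusPoly_deck hω0 x
      rw [← h] at h5
      rw [div_pow, mul_pow, mul_pow, h4, I_sq]
      field_simp
      linear_combination (-mobiusPoly (ω 1) x) * h5

end MobiusInvariants

/-- Two disjoint simple closed curves in the open Möbius strip always
disconnect it: if `γ₁, γ₂ ⊆ M` are disjoint simple closed curves, then
`M \ (γ₁ ∪ γ₂)` is disconnected. -/
theorem two_disjoint_circles_disconnect_mobius
    (γ₁ γ₂ : Set OpenMobius)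
    (h₁ : IsSimpleClosedCurve γ₁) (h₂ : IsSimpleClosedCurve γ₂)
    (hdisj : Disjoint γ₁ γ₂) :
    ¬ IsPreconnected ((γ₁ ∪ γ₂)ᶜ) := by
  intro hconn
  obtain ⟨A₁, B₁, p₁, q₁, ω₁, η₁, hA₁, hB₁, rfl, hAB₁, hpq₁, hp₁, hq₁, hω₁, hη₁, hsA₁, hsB₁⟩ :=
    h₁.exists_arcs
  obtain ⟨A₂, B₂, p₂, q₂, ω₂, η₂, hA₂, hB₂, rfl, hAB₂, hpq₂, hp₂, hq₂, hω₂, hη₂, hsA₂, hsB₂⟩ :=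
    h₂.exists_arcs
  set f₁ : OpenMobius → ℂ := fun x => mobiusPoly ω₁ x * mobiusPoly η₁ x with hf₁
  set f₂ : OpenMobius → ℂ := fun x => mobiusPoly ω₂ x * mobiusPoly η₂ x with hf₂
  have hc₁ : Continuous f₁ := (continuous_mobiusPoly _).mul (continuous_mobiusPoly _)
  have hc₂ : Continuous f₂ := (continuous_mobiusPoly _).mul (continuous_mobiusPoly _)
  have hz₁ : ∀ {x}, f₁ x = 0 → x = p₁ ∨ x = q₁ := fun {x} h =>
    (mul_eq_zero.1 h).imp (eq_of_mobiusPoly_eq_zero · hω₁) (eq_of_mobiusPoly_eq_zero · hη₁)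
  have hz₂ : ∀ {x}, f₂ x = 0 → x = p₂ ∨ x = q₂ := fun {x} h =>
    (mul_eq_zero.1 h).imp (eq_of_mobiusPoly_eq_zero · hω₂) (eq_of_mobiusPoly_eq_zero · hη₂)
  have hne : ∀ {x y}, x ∈ A₁ ∪ B₁ → y ∈ A₂ ∪ B₂ → x ≠ y := fun hx hy =>
    hdisj.ne_of_mem hx hy
  have hp₁0 : f₂ p₁ ≠ 0 := fun h => (hz₂ h).elim (hne hp₁ hp₂) (hne hp₁ hq₂)
  have hp₂0 : f₁ p₂ ≠ 0 := fun h => (hz₁ h).elim (hne hp₁ hp₂).symm (hne hq₁ hp₂).symm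
  have hη₁0 : mobiusPoly η₁ p₁ ≠ 0 := fun h => hpq₁ (eq_of_mobiusPoly_eq_zero h hη₁)
  have hη₂0 : mobiusPoly η₂ p₂ ≠ 0 := fun h => hpq₂ (eq_of_mobiusPoly_eq_zero h hη₂)
  have hsq : ∀ {g : OpenMobius → ℂ} (U : Set OpenMobius), Continuous g →
      HasSqrtOn (fun x => g x * g x) U := fun {g} U hg =>
    ⟨g, hg.continuousOn, fun x _ => sq (g x)⟩
  have hUA₁ : (A₁ ∪ A₂)ᶜ ⊆ A₁ᶜ := Set.compl_subset_compl.2 Set.subset_union_left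
  have hUA₂ : (A₁ ∪ A₂)ᶜ ⊆ A₂ᶜ := Set.compl_subset_compl.2 Set.subset_union_right
  have hUB₁ : (B₁ ∪ B₂)ᶜ ⊆ B₁ᶜ := Set.compl_subset_compl.2 Set.subset_union_left
  have hUB₂ : (B₁ ∪ B₂)ᶜ ⊆ B₂ᶜ := Set.compl_subset_compl.2 Set.subset_union_right
  have hzero : ∀ x, x ∉ (A₁ ∪ A₂)ᶜ ∪ (B₁ ∪ B₂)ᶜ → f₁ x * f₂ x = 0 := fun x hx => by
    rw [← Set.compl_inter, Set.mem_compl_iff, not_not] at hx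
    obtain ⟨hxA | hxA, hxB | hxB⟩ := hx
    · rcases hAB₁ ⟨hxA, hxB⟩ with h | h <;> rw [h] <;> simp [hf₁, hω₁, hη₁]
    · exact absurd rfl (hne (Or.inl hxA) (Or.inr hxB))
    · exact absurd rfl (hne (Or.inr hxB) (Or.inl hxA))
    · rcases hAB₂ ⟨hxA, hxB⟩ with h | h <;> rw [h] <;> simp [hf₂, hω₂, hη₂]
  have hnz : ∀ x ∈ (A₁ ∪ A₂)ᶜ ∩ (B₁ ∪ B₂)ᶜ, f₁ x ≠ 0 ∧ f₂ x ≠ 0 := fun x hx => by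
    have hx1 : x ∉ A₁ ∪ B₁ := fun h => h.elim (fun h => hx.1 (Or.inl h)) fun h => hx.2 (Or.inl h)
    have hx2 : x ∉ A₂ ∪ B₂ := fun h => h.elim (fun h => hx.1 (Or.inr h)) fun h => hx.2 (Or.inr h)
    exact ⟨fun h => (hz₁ h).elim (fun e => hx1 (e ▸ hp₁)) fun e => hx1 (e ▸ hq₁),
      fun h => (hz₂ h).elim (fun e => hx2 (e ▸ hp₂)) fun e => hx2 (e ▸ hq₂)⟩
  have hconn' : IsPreconnected ((A₁ ∪ A₂)ᶜ ∩ (B₁ ∪ B₂)ᶜ) := by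
    rwa [← Set.compl_union, Set.union_union_union_comm]
  have hglue : ∀ g : OpenMobius → ℂ, (∀ x, f₁ x ≠ 0 → f₂ x ≠ 0 → g x ≠ 0) →
      (∀ x, g x ≠ 0 → f₁ x * f₂ x ≠ 0) → HasSqrtOn g (A₁ ∪ A₂)ᶜ → HasSqrtOn g (B₁ ∪ B₂)ᶜ →
      HasSqrtOn g {x | g x ≠ 0} := fun g hg hg' hgA hgB =>
    (HasSqrtOn.union (hA₁.union hA₂).isOpen_compl (hB₁.union hB₂).isOpen_compl hconn'
      (fun x hx => hg x (hnz x hx).1 (hnz x hx).2) hgA hgB).mono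
      fun x hx => by_contra fun hx' => hg' x hx (hzero x hx')
  have hA₁' := hsA₁.mono hUA₁
  have hA₂' := hsA₂.mono hUA₂
  rcases hsB₁ with hB₁' | hB₁'
  · refine not_hasSqrtOn_mobiusPoly_mul hω₁ (k := fun x => mobiusPoly η₁ x * (f₂ x * f₂ x))
      ((continuous_mobiusPoly _).mul (hc₂.mul hc₂)) (mul_ne_zero hη₁0 (mul_ne_zero hp₁0 hp₁0)) ?_
    simp only [← mul_assoc (mobiusPoly ω₁ _)]
    exact hglue (fun x => f₁ x * (f₂ x * f₂ x))
      (fun x h h' => mul_ne_zero h (mul_ne_zero h' h'))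
      (fun x h h' => h (by rw [← mul_assoc, h', zero_mul]))
      (hA₁'.mul (hsq _ hc₂)) ((hB₁'.mono hUB₁).mul (hsq _ hc₂))
  rcases hsB₂ with hB₂' | hB₂'
  · refine not_hasSqrtOn_mobiusPoly_mul hω₂ (k := fun x => mobiusPoly η₂ x * (f₁ x * f₁ x))
      ((continuous_mobiusPoly _).mul (hc₁.mul hc₁)) (mul_ne_zero hη₂0 (mul_ne_zero hp₂0 hp₂0)) ?_
    simp only [← mul_assoc (mobiusPoly ω₂ _)]
    exact hglue (fun x => f₂ x * (f₁ x * f₁ x))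
      (fun x h h' => mul_ne_zero h' (mul_ne_zero h h))
      (fun x h h' => h (by rw [← mul_assoc, mul_comm (f₂ x), h', zero_mul]))
      (hA₂'.mul (hsq _ hc₁)) ((hB₂'.mono hUB₂).mul (hsq _ hc₁))
  · refine not_hasSqrtOn_mobiusPoly_mul hω₁ (k := fun x => mobiusPoly η₁ x * f₂ x)
      ((continuous_mobiusPoly _).mul hc₂) (mul_ne_zero hη₁0 hp₁0) ?_
    simp only [← mul_assoc (mobiusPoly ω₁ _)]
    refine hglue (fun x => f₁ x * f₂ x) (fun x => mul_ne_zero) (fun x => id)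
      (hA₁'.mul hA₂') ?_
    exact HasSqrtOn.of_sq_mul continuous_mobiusAngle.continuousOn
      (fun x _ => mobiusAngle_ne_zero x) ((hB₁'.mono hUB₁).mul (hB₂'.mono hUB₂))
      (fun x _ => by ring)
end

section
/- Every simple closed curve in S² that does not disconnect its complement into pieces exchanged by the antipodal map and that disconnects S² into two disks has both complementary components homeomorphic to open disks (Jordan–Schoenflies on the sphere): for any subset C of S² homeomorphic to S¹, the complement S² \ C has exactly two connected components, each homeomorphic to the open unit disk, and each has C as its frontier. -/
section JordanSchoenflies

open Set Metric Filter Topology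

/-- `f` has a continuous logarithm on `s`. -/
def HasLogOn {X : Type*} [TopologicalSpace X] (f : X → ℂ) (s : Set X) : Prop :=
  ∃ g : X → ℂ, ContinuousOn g s ∧ ∀ x ∈ s, Complex.exp (g x) = f x

namespace HasLogOn

variable {X : Type*} [TopologicalSpace X] {f f₁ f₂ : X → ℂ} {s t : Set X}

lemma mono (h : HasLogOn f t) (hst : s ⊆ t) : HasLogOn f s := by
  obtain ⟨g, hg, hgf⟩ := h
  exact ⟨g, hg.mono hst, fun x hx => hgf x (hst hx)⟩

lemma congr (h : HasLogOn f₁ s) (hf : EqOn f₁ f₂ s) : HasLogOn f₂ s := by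
  obtain ⟨g, hg, hgf⟩ := h
  exact ⟨g, hg, fun x hx => (hgf x hx).trans (hf hx)⟩

lemma mul (h₁ : HasLogOn f₁ s) (h₂ : HasLogOn f₂ s) : HasLogOn (fun x => f₁ x * f₂ x) s := by
  obtain ⟨g₁, hg₁, hgf₁⟩ := h₁
  obtain ⟨g₂, hg₂, hgf₂⟩ := h₂
  exact ⟨fun x => g₁ x + g₂ x, hg₁.add hg₂, fun x hx => by
    rw [Complex.exp_add, hgf₁ x hx, hgf₂ x hx]⟩

lemma zpow (h : HasLogOn f s) (n : ℤ) : HasLogOn (fun x => f x ^ n) s := by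
  obtain ⟨g, hg, hgf⟩ := h
  exact ⟨fun x => n * g x, continuousOn_const.mul hg, fun x hx => by
    rw [Complex.exp_int_mul, hgf x hx]⟩

lemma const {c : ℂ} (hc : c ≠ 0) : HasLogOn (fun _ : X => c) s :=
  ⟨fun _ => Complex.log c, continuousOn_const, fun _ _ => Complex.exp_log hc⟩

lemma of_norm_sub_one_lt (hf : ContinuousOn f s) (h : ∀ x ∈ s, ‖f x - 1‖ < 1) : HasLogOn f s := by
  have hmem : ∀ x ∈ s, f x ∈ Complex.slitPlane := fun x hx =>
    Complex.ball_one_subset_slitPlane (by simpa [dist_eq_norm] using h x hx)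
  exact ⟨fun x => Complex.log (f x), hf.clog hmem, fun x hx =>
    Complex.exp_log (Complex.slitPlane_ne_zero (hmem x hx))⟩

lemma of_contractible [ContractibleSpace X] [LocallyPathConnectedSpace X] (hf : Continuous f)
    (h : ∀ x, f x ≠ 0) : HasLogOn f univ := by
  obtain ⟨g, hg, hgf⟩ := Complex.exists_continuousOn_eqOn_exp_comp (U := (univ : Set X)) (g := f)
    (by
      have : SimplyConnectedSpace X := inferInstance
      have e := Homeomorph.Set.univ X
      exact e.toHomotopyEquiv.simplyConnectedSpace) isOpen_univ hf.continuousOn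
    (by rintro ⟨x, -, hx⟩; exact h x hx)
  exact ⟨g, hg, fun x hx => hgf hx⟩

end HasLogOn

/-- A continuous function on a preconnected set whose exponential is constantly `1` is constant. -/
lemma eqOn_of_exp_eq_one {X : Type*} [TopologicalSpace X] {s : Set X} (hs : IsPreconnected s)
    {g : X → ℂ} (hg : ContinuousOn g s) (h : ∀ x ∈ s, Complex.exp (g x) = 1) {x y : X}
    (hx : x ∈ s) (hy : y ∈ s) : g x = g y := by
  have hpi : (2 * Real.pi * Complex.I : ℂ) ≠ 0 := Complex.two_pi_I_ne_zero
  have key : ∀ x ∈ s, ∃ n : ℤ, g x / (2 * Real.pi * Complex.I) = n := by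
    intro x hx
    obtain ⟨n, hn⟩ := Complex.exp_eq_one_iff.1 (h x hx)
    exact ⟨n, by rw [hn]; field_simp⟩
  have hre : ContinuousOn (fun x => (g x / (2 * Real.pi * Complex.I)).re) s :=
    Complex.continuous_re.comp_continuousOn (hg.div_const _)
  have hcon : g x / (2 * Real.pi * Complex.I) = g y / (2 * Real.pi * Complex.I) := by
    obtain ⟨n, hn⟩ := key x hx
    obtain ⟨m, hm⟩ := key y hy
    have himg := hs.image _ hre
    have hx' : (n : ℝ) ∈ (fun x => (g x / (2 * Real.pi * Complex.I)).re) '' s :=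
      ⟨x, hx, by simp [hn]⟩
    have hy' : (m : ℝ) ∈ (fun x => (g x / (2 * Real.pi * Complex.I)).re) '' s :=
      ⟨y, hy, by simp [hm]⟩
    have hoc := himg.ordConnected
    have hval : ∀ a ∈ (fun x => (g x / (2 * Real.pi * Complex.I)).re) '' s, ∃ k : ℤ, a = k := by
      rintro _ ⟨z, hz, rfl⟩
      obtain ⟨k, hk⟩ := key z hz
      exact ⟨k, by simp [hk]⟩
    have hnm : n = m := by
      by_contra hne
      wlog hlt : n < m generalizing n m x y
      · exact this hy hx m hm n hn hy' hx' (Ne.symm hne)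
          (lt_of_le_of_ne (not_lt.1 hlt) (Ne.symm hne))
      have h1 : (n : ℝ) + 1 ≤ m := by exact_mod_cast hlt
      obtain ⟨k, hk⟩ := hval ((n : ℝ) + 1 / 2) (hoc.out hx' hy' ⟨by linarith, by linarith⟩)
      have h2 : ((2 * n + 1 : ℤ) : ℝ) = ((2 * k : ℤ) : ℝ) := by push_cast; linarith
      have h3 : 2 * n + 1 = 2 * k := by exact_mod_cast h2
      omega
    rw [hn, hm, hnm]
  field_simp at hcon
  exact hcon

/-- Nontrivial powers of `z - p` have no continuous logarithm on circles around `p`. -/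
lemma HasLogOn.eq_zero_of_sphere {p : ℂ} {r : ℝ} (hr : 0 < r) {n : ℤ}
    (h : HasLogOn (fun z => (z - p) ^ n) (sphere p r)) : n = 0 := by
  obtain ⟨g, hg, hgf⟩ := h
  have hmem : ∀ θ : ℝ, circleMap p r θ ∈ sphere p r := fun θ => circleMap_mem_sphere p hr.le θ
  set c : ℝ → ℂ := fun θ => g (circleMap p r θ) - n * (Complex.log r + θ * Complex.I) with hc
  have hcc : ContinuousOn c univ := by
    refine ContinuousOn.sub (hg.comp (continuous_circleMap p r).continuousOn fun θ _ => hmem θ) ?_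
    fun_prop
  have hexp : ∀ θ ∈ (univ : Set ℝ), Complex.exp (c θ) = 1 := by
    intro θ _
    have hr0 : (r : ℂ) ≠ 0 := by exact_mod_cast hr.ne'
    have hne : ((r : ℂ) * Complex.exp (θ * Complex.I)) ≠ 0 := by simp [hr0]
    rw [hc]
    simp only
    rw [Complex.exp_sub, hgf _ (hmem θ), Complex.exp_int_mul, Complex.exp_add, Complex.exp_log hr0]
    simp only [circleMap, add_sub_cancel_left]
    exact div_self (zpow_ne_zero _ hne)
  have := eqOn_of_exp_eq_one isPreconnected_univ hcc hexp (mem_univ 0) (mem_univ (2 * Real.pi))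
  simp only [hc] at this
  have hper : circleMap p r (2 * Real.pi) = circleMap p r 0 := by simp [circleMap]
  rw [hper] at this
  have h0 : (n : ℂ) * (2 * Real.pi * Complex.I) = 0 := by
    push_cast at this
    linear_combination this
  have := (mul_eq_zero.1 h0).resolve_right Complex.two_pi_I_ne_zero
  exact_mod_cast this

lemma exists_continuous_log_comp {γ : ℝ → ℂ} {a b : ℝ} (hab : a ≤ b)
    (hγ : ContinuousOn γ (Icc a b)) {f : ℂ → ℂ} (hf : ContinuousOn f (γ '' Icc a b))
    (hf0 : ∀ z ∈ γ '' Icc a b, f z ≠ 0) :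
    ∃ l : ℝ → ℂ, ContinuousOn l (Icc a b) ∧ ∀ t ∈ Icc a b, Complex.exp (l t) = f (γ t) := by
  have hcont : ContinuousOn (fun t => f (γ t)) (Icc a b) := hf.comp hγ (mapsTo_image γ _)
  have hc : Continuous (fun t : ℝ => f (γ (projIcc a b hab t))) :=
    hcont.comp_continuous (continuous_subtype_val.comp continuous_projIcc)
      fun t => (projIcc a b hab t).2
  obtain ⟨l, hl, hlf⟩ := HasLogOn.of_contractible hc
    fun t => hf0 _ (mem_image_of_mem γ (projIcc a b hab t).2)
  exact ⟨l, hl.mono (subset_univ _), fun t ht => by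
    simp only [hlf t (mem_univ t), projIcc_of_mem hab ht]⟩

lemma HasLogOn.of_comp {γ : ℝ → ℂ} {a b : ℝ} (hγ : ContinuousOn γ (Icc a b)) {f : ℂ → ℂ}
    {l : ℝ → ℂ} (hl : ContinuousOn l (Icc a b))
    (hlf : ∀ t ∈ Icc a b, Complex.exp (l t) = f (γ t))
    (hcompat : ∀ s ∈ Icc a b, ∀ t ∈ Icc a b, γ s = γ t → l s = l t) :
    HasLogOn f (γ '' Icc a b) := by
  classical
  have hsel : ∀ z : ℂ, ∃ t : ℝ, z ∈ γ '' Icc a b → t ∈ Icc a b ∧ γ t = z := by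
    intro z
    by_cases hz : z ∈ γ '' Icc a b
    · obtain ⟨t, ht, htz⟩ := hz
      exact ⟨t, fun _ => ⟨ht, htz⟩⟩
    · exact ⟨0, fun h => absurd h hz⟩
  choose τ hτ using hsel
  have hlτ : ∀ t ∈ Icc a b, l (τ (γ t)) = l t := fun t ht =>
    hcompat _ (hτ _ ⟨t, ht, rfl⟩).1 _ ht (hτ _ ⟨t, ht, rfl⟩).2
  refine ⟨fun z => l (τ z), ?_, ?_⟩
  · rw [continuousOn_iff_isClosed]
    intro C hC
    obtain ⟨u, hu, huC⟩ := continuousOn_iff_isClosed.1 hl C hC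
    refine ⟨γ '' (u ∩ Icc a b), ?_, ?_⟩
    · exact ((isCompact_Icc.inter_left hu).image_of_continuousOn
        (hγ.mono inter_subset_right)).isClosed
    · rw [← huC]
      ext z
      constructor
      · rintro ⟨hz, ⟨t, ht, rfl⟩⟩
        refine ⟨⟨t, ⟨?_, ht⟩, rfl⟩, ⟨t, ht, rfl⟩⟩
        simpa only [mem_preimage, hlτ t ht] using hz
      · rintro ⟨⟨t, ⟨h1, ht⟩, rfl⟩, h2⟩
        refine ⟨?_, h2⟩
        simpa only [mem_preimage, hlτ t ht] using h1
  · rintro _ ⟨t, ht, rfl⟩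
    simp only [hlτ t ht, hlf t ht]

/-- Every continuous nonvanishing function on an arc has a continuous logarithm. -/
lemma HasLogOn.of_arc {γ : ℝ → ℂ} {a b : ℝ} (hab : a ≤ b) (hγ : ContinuousOn γ (Icc a b))
    (hinj : InjOn γ (Icc a b)) {f : ℂ → ℂ} (hf : ContinuousOn f (γ '' Icc a b))
    (hf0 : ∀ z ∈ γ '' Icc a b, f z ≠ 0) : HasLogOn f (γ '' Icc a b) := by
  obtain ⟨l, hl, hlf⟩ := exists_continuous_log_comp hab hγ hf hf0
  exact .of_comp hγ hl hlf fun s hs t ht h => by rw [hinj hs ht h]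

/-- If `(z - p) ^ n * u z` has a continuous logarithm on the frontier of a bounded open set `D`
containing `p`, where `u` is continuous and nonvanishing on `closure D`, then `n = 0`. -/
lemma HasLogOn.eq_zero_of_frontier_subset {K D : Set ℂ} (hK : IsClosed K) (hD : IsOpen D)
    (hDb : Bornology.IsBounded D) (hDK : frontier D ⊆ K) {p : ℂ} (hp : p ∈ D) {n : ℤ} {u : ℂ → ℂ}
    (hu : ContinuousOn u (closure D)) (hu0 : ∀ z ∈ closure D, u z ≠ 0)
    (h : HasLogOn (fun z => (z - p) ^ n * u z) K) : n = 0 := by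
  classical
  obtain ⟨g, hg, hgf⟩ := h
  obtain ⟨G, hG⟩ := ContinuousMap.exists_restrict_eq hK
    (⟨K.domRestrict g, continuousOn_iff_continuous_domRestrict.1 hg⟩ : C(K, ℂ))
  have hGg : ∀ z ∈ K, G z = g z := fun z hz => DFunLike.congr_fun hG (⟨z, hz⟩ : K)
  have hnep : ∀ z ∈ Dᶜ, z - p ≠ 0 := fun z hz h0 => hz (by rwa [sub_eq_zero.1 h0])
  set H : ℂ → ℂ := D.piecewise u (fun z => Complex.exp (G z) * (z - p) ^ (-n)) with hH
  have hHc : Continuous H := by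
    refine continuous_piecewise ?_ hu ?_
    · intro z hz
      have hzD : z ∈ Dᶜ := by
        rw [hD.frontier_eq] at hz
        exact hz.2
      rw [hGg z (hDK hz), hgf z (hDK hz), zpow_neg]
      have := zpow_ne_zero n (hnep z hzD)
      field_simp
    · rw [hD.isClosed_compl.closure_eq]
      refine ContinuousOn.mul (by fun_prop) ?_
      exact ContinuousOn.zpow₀ (by fun_prop) _ fun z hz => Or.inl (hnep z hz)
  have hH0 : ∀ z, H z ≠ 0 := by
    intro z
    by_cases hz : z ∈ D
    · rw [hH, piecewise_eq_of_mem _ _ _ hz]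
      exact hu0 z (subset_closure hz)
    · rw [hH, piecewise_eq_of_notMem _ _ _ hz]
      exact mul_ne_zero (Complex.exp_ne_zero _) (zpow_ne_zero _ (hnep z hz))
  obtain ⟨k, hk, hkH⟩ := HasLogOn.of_contractible hHc hH0
  obtain ⟨R, hR⟩ := hDb.subset_ball p
  have hR0 : 0 < R := by
    by_contra hneg
    have := hR hp
    simp [ball_eq_empty.2 (not_lt.1 hneg)] at this
  refine HasLogOn.eq_zero_of_sphere (p := p) hR0 ⟨fun z => G z - k z,
    (G.continuous.continuousOn.sub (hk.mono (subset_univ _))), fun z hz => ?_⟩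
  have hzD : z ∉ D := fun hzD => by
    have h1 := hR hzD
    rw [mem_ball] at h1
    rw [mem_sphere] at hz
    linarith
  rw [Complex.exp_sub, hkH z (mem_univ z), hH, piecewise_eq_of_notMem _ _ _ hzD, zpow_neg]
  have h1 := zpow_ne_zero n (hnep z hzD)
  have h2 := Complex.exp_ne_zero (G z)
  field_simp

lemma isPreconnected_norm_gt {R : ℝ} (hR : 0 < R) : IsPreconnected {z : ℂ | R < ‖z‖} := by
  have : {z : ℂ | R < ‖z‖} = Complex.exp '' {z : ℂ | Real.log R < z.re} := by
    ext z
    constructor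
    · intro hz
      have hz0 : z ≠ 0 := norm_pos_iff.1 (hR.trans hz)
      exact ⟨Complex.log z, by simpa [Complex.log_re] using Real.log_lt_log hR hz,
        Complex.exp_log hz0⟩
    · rintro ⟨w, hw, rfl⟩
      simpa [Complex.norm_exp, Real.log_lt_iff_lt_exp hR] using hw
  rw [this]
  exact ((convex_halfSpace_re_gt _).isPreconnected).image _ Complex.continuous_exp.continuousOn

lemma frontier_connectedComponentIn_compl_subset {K : Set ℂ} (hK : IsClosed K) (x : ℂ) :
    frontier (connectedComponentIn Kᶜ x) ⊆ K := by
  intro y hy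
  by_contra hyK
  have hopen := hK.isOpen_compl.connectedComponentIn (x := x)
  rw [hopen.frontier_eq] at hy
  obtain ⟨z, hz1, hz2⟩ := mem_closure_iff.1 hy.1 _ (hK.isOpen_compl.connectedComponentIn (x := y))
    (mem_connectedComponentIn hyK)
  refine hy.2 ?_
  rw [connectedComponentIn_eq hz2, ← connectedComponentIn_eq hz1]
  exact mem_connectedComponentIn hyK

/-- A compact subset of the plane on which all translates `z - p` have logarithms does not separate
the plane. -/
lemma isPreconnected_compl_of_hasLogOn {K : Set ℂ} (hK : IsCompact K)
    (h : ∀ p ∉ K, HasLogOn (fun z => z - p) K) : IsPreconnected Kᶜ := by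
  obtain ⟨R, hR0, hR⟩ : ∃ R : ℝ, 0 < R ∧ K ⊆ closedBall 0 R := by
    obtain ⟨R, hR⟩ := hK.isBounded.subset_closedBall 0
    exact ⟨max R 1, by positivity, hR.trans (closedBall_subset_closedBall (le_max_left _ _))⟩
  have hout : {z : ℂ | R < ‖z‖} ⊆ Kᶜ := fun z hz hzK => by
    have := hR hzK
    simp only [mem_closedBall, dist_zero_right] at this
    exact absurd hz (not_lt.2 this)
  have key : ∀ x ∈ Kᶜ, ∃ y ∈ connectedComponentIn Kᶜ x, R < ‖y‖ := by
    intro x hx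
    by_contra! hcon
    have hb : Bornology.IsBounded (connectedComponentIn Kᶜ x) :=
      (isBounded_closedBall (x := (0 : ℂ)) (r := R)).subset fun y hy => by simpa using hcon y hy
    have := HasLogOn.eq_zero_of_frontier_subset (n := 1) (u := fun _ => 1) hK.isClosed
      hK.isClosed.isOpen_compl.connectedComponentIn hb
      (frontier_connectedComponentIn_compl_subset hK.isClosed x) (mem_connectedComponentIn hx)
      continuousOn_const (fun _ _ => one_ne_zero) (by simpa using h x hx)
    exact one_ne_zero this
  refine isPreconnected_of_forall_pair fun x hx y hy => ?_
  obtain ⟨x', hx', hxR⟩ := key x hx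
  obtain ⟨y', hy', hyR⟩ := key y hy
  have hsub : {z : ℂ | R < ‖z‖} ⊆ connectedComponentIn Kᶜ x' :=
    (isPreconnected_norm_gt hR0).subset_connectedComponentIn hxR hout
  rw [← connectedComponentIn_eq hx'] at hsub
  refine ⟨connectedComponentIn Kᶜ x, connectedComponentIn_subset _ _, mem_connectedComponentIn hx,
    ?_, isPreconnected_connectedComponentIn⟩
  rw [connectedComponentIn_eq (hsub hyR), ← connectedComponentIn_eq hy']
  exact mem_connectedComponentIn hy

/-- For an arc from `γ a` to `γ b`, the quotient `(z - γ b) / (z - γ a)` has a logarithm off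
the arc. -/
lemma hasLogOn_div_compl_image {γ : ℝ → ℂ} {a b : ℝ} (hab : a ≤ b)
    (hγ : ContinuousOn γ (Icc a b)) :
    HasLogOn (fun z => (z - γ b) / (z - γ a)) (γ '' Icc a b)ᶜ := by
  classical
  set A := γ '' Icc a b with hA
  have hAc : IsClosed A := (isCompact_Icc.image_of_continuousOn hγ).isClosed
  have ha : a ∈ Icc a b := left_mem_Icc.2 hab
  have hb : b ∈ Icc a b := right_mem_Icc.2 hab
  have hne : ∀ x ∈ Aᶜ, ∀ t ∈ Icc a b, x - γ t ≠ 0 := fun x hx t ht h0 =>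
    hx ⟨t, ht, (sub_eq_zero.1 h0).symm⟩
  have hlift : ∀ x : ℂ, ∃ l : ℝ → ℂ, x ∈ Aᶜ → ContinuousOn l (Icc a b) ∧
      ∀ t ∈ Icc a b, Complex.exp (l t) = x - γ t := by
    intro x
    by_cases hx : x ∈ Aᶜ
    · obtain ⟨l, hl⟩ := exists_continuous_log_comp (f := fun w => x - w) hab hγ
        (by fun_prop) (by rintro _ ⟨t, ht, rfl⟩; exact hne x hx t ht)
      exact ⟨l, fun _ => hl⟩
    · exact ⟨0, fun h => absurd h hx⟩
  choose l hl using hlift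
  refine ⟨fun x => l x b - l x a, ?_, fun x hx => ?_⟩
  · intro x₀ hx₀
    have hev : ∀ᶠ x in 𝓝 x₀, l x b - l x a = l x₀ b - l x₀ a +
        (Complex.log ((x - γ b) / (x₀ - γ b)) - Complex.log ((x - γ a) / (x₀ - γ a))) := by
      obtain ⟨δ, hδ, hball⟩ := Metric.isOpen_iff.1 hAc.isOpen_compl x₀ hx₀
      filter_upwards [ball_mem_nhds x₀ hδ] with x hx
      have hxA : x ∈ Aᶜ := hball hx
      have hmem : ∀ t ∈ Icc a b, (x - γ t) / (x₀ - γ t) ∈ Complex.slitPlane := by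
        intro t ht
        apply Complex.ball_one_subset_slitPlane
        have h1 : δ ≤ ‖x₀ - γ t‖ := by
          by_contra hlt
          exact hball (a := γ t) (by rw [mem_ball, dist_comm, dist_eq_norm]; linarith) ⟨t, ht, rfl⟩
        have h2 : (x - γ t) / (x₀ - γ t) - 1 = (x - x₀) / (x₀ - γ t) := by
          field_simp [hne x₀ hx₀ t ht]
          ring
        rw [mem_ball, dist_eq_norm, h2, norm_div, div_lt_one (hδ.trans_le h1)]
        rw [mem_ball, dist_eq_norm] at hx
        linarith
      have hcont : ContinuousOn (fun t => l x t - l x₀ t - Complex.log ((x - γ t) / (x₀ - γ t)))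
          (Icc a b) := by
        refine ((hl x hxA).1.sub (hl x₀ hx₀).1).sub (ContinuousOn.clog ?_ hmem)
        exact ContinuousOn.div (by fun_prop) (by fun_prop) (hne x₀ hx₀)
      have := eqOn_of_exp_eq_one isPreconnected_Icc hcont (fun t ht => by
        rw [Complex.exp_sub, Complex.exp_sub, (hl x hxA).2 t ht, (hl x₀ hx₀).2 t ht,
          Complex.exp_log (Complex.slitPlane_ne_zero (hmem t ht))]
        exact div_self (div_ne_zero (hne x hxA t ht) (hne x₀ hx₀ t ht))) hb ha
      linear_combination this
    refine ContinuousAt.continuousWithinAt ?_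
    refine ContinuousAt.congr ?_ (hev.mono fun x hx => hx.symm)
    have hlog : ∀ t ∈ Icc a b, ContinuousAt (fun x => Complex.log ((x - γ t) / (x₀ - γ t))) x₀ := by
      intro t ht
      refine ContinuousAt.clog (by fun_prop) ?_
      rw [div_self (hne x₀ hx₀ t ht)]
      exact Complex.one_mem_slitPlane
    exact continuousAt_const.add ((hlog b hb).sub (hlog a ha))
  · simp only
    rw [Complex.exp_sub, (hl x hx).2 b hb, (hl x hx).2 a ha]

/-- A `1`-periodic parametrization of a simple closed curve in the plane. -/
structure IsJordanParam (γ : ℝ → ℂ) : Prop where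
  continuous : Continuous γ
  periodic : Function.Periodic γ 1
  exists_int : ∀ s t, γ s = γ t → ∃ n : ℤ, t = s + n

namespace IsJordanParam

variable {γ : ℝ → ℂ} (hγ : IsJordanParam γ)
include hγ

lemma range_eq : range γ = γ '' Icc 0 1 := by
  have := hγ.periodic.image_Icc one_pos 0
  simpa using this.symm

lemma isCompact_range : IsCompact (range γ) := by
  rw [hγ.range_eq]
  exact isCompact_Icc.image hγ.continuous

lemma injOn {a b : ℝ} (hab : b < a + 1) : InjOn γ (Icc a b) := by
  intro s hs t ht h
  obtain ⟨n, hn⟩ := hγ.exists_int s t h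
  have h1 : (n : ℝ) < 1 := by linarith [hs.1, ht.2]
  have h2 : (-1 : ℝ) < n := by linarith [hs.2, ht.1]
  have h3 : n < 1 := by exact_mod_cast h1
  have h4 : -1 < n := by exact_mod_cast h2
  obtain rfl : n = 0 := by omega
  simpa using hn.symm

lemma not_isPreconnected_compl : ¬ IsPreconnected (range γ)ᶜ := by
  classical
  intro hpre
  set A := γ '' Icc 0 (1 / 2) with hA
  set B := γ '' Icc (1 / 2) 1 with hB
  set a := γ 0 with ha
  set b := γ (1 / 2) with hb
  have h1 : γ 1 = a := by simpa using hγ.periodic 0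
  have hab : a ≠ b := fun h => by
    have := hγ.injOn (a := 0) (b := 1 / 2) (by norm_num) (by norm_num) (by norm_num) h
    norm_num at this
  have hAc : IsOpen Aᶜ := (isCompact_Icc.image hγ.continuous).isClosed.isOpen_compl
  have hBc : IsOpen Bᶜ := (isCompact_Icc.image hγ.continuous).isClosed.isOpen_compl
  have hAB : ∀ z ∈ A, z ∈ B → z = a ∨ z = b := by
    rintro _ ⟨s, hs, rfl⟩ ⟨t, ht, hst⟩
    obtain ⟨n, hn⟩ := hγ.exists_int t s hst
    have h2 : (n : ℝ) ≤ 0 := by linarith [hs.2, ht.1]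
    have h3 : (-1 : ℝ) ≤ n := by linarith [hs.1, ht.2]
    have h4 : n ≤ 0 := by exact_mod_cast h2
    have h5 : -1 ≤ n := by exact_mod_cast h3
    obtain rfl | rfl : n = 0 ∨ n = -1 := by omega
    · right
      have : s = 1 / 2 := le_antisymm hs.2 (by push_cast at hn; linarith [ht.1])
      rw [this]
    · left
      have : s = 0 := le_antisymm (by push_cast at hn; linarith [ht.2]) hs.1
      rw [this]
  have hun : range γ = A ∪ B := by
    rw [hγ.range_eq, hA, hB, ← image_union, Icc_union_Icc_eq_Icc] <;> norm_num
  obtain ⟨gA, hgA, hgA'⟩ := hasLogOn_div_compl_image (a := 0) (b := 1 / 2) (by norm_num)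
    hγ.continuous.continuousOn
  obtain ⟨gB, hgB, hgB'⟩ := hasLogOn_div_compl_image (a := 1 / 2) (b := 1) (by norm_num)
    hγ.continuous.continuousOn
  rw [h1] at hgB'
  replace hgA' : ∀ x ∈ Aᶜ, Complex.exp (gA x) = (x - b) / (x - a) := hgA'
  replace hgB' : ∀ x ∈ Bᶜ, Complex.exp (gB x) = (x - a) / (x - b) := hgB'
  have hJA : (range γ)ᶜ ⊆ Aᶜ := compl_subset_compl.2 (hun ▸ subset_union_left)
  have hJB : (range γ)ᶜ ⊆ Bᶜ := compl_subset_compl.2 (hun ▸ subset_union_right)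
  have haR : a ∈ range γ := ⟨0, rfl⟩
  have hbR : b ∈ range γ := ⟨1 / 2, rfl⟩
  have hexp : ∀ z ∈ (range γ)ᶜ, Complex.exp (gA z + gB z) = 1 := by
    intro z hz
    have hza : z - a ≠ 0 := fun h => hz (sub_eq_zero.1 h ▸ haR)
    have hzb : z - b ≠ 0 := fun h => hz (sub_eq_zero.1 h ▸ hbR)
    rw [Complex.exp_add, hgA' z (hJA hz), hgB' z (hJB hz)]
    field_simp
  obtain ⟨z₀, hz₀⟩ : ((range γ)ᶜ).Nonempty := by
    rw [nonempty_compl]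
    intro h
    exact noncompact_univ ℂ (h ▸ hγ.isCompact_range)
  have hconst : ∀ z ∈ (range γ)ᶜ, gA z + gB z = gA z₀ + gB z₀ := fun z hz =>
    eqOn_of_exp_eq_one hpre ((hgA.mono hJA).add (hgB.mono hJB)) hexp hz hz₀
  set g : ℂ → ℂ := fun z => if z ∈ A then gA z₀ + gB z₀ - gB z else gA z with hg
  have hglue : ∀ z ∉ B, g z = gA z₀ + gB z₀ - gB z := by
    intro z hz
    by_cases hzA : z ∈ A
    · simp [hg, hzA]
    · have hzJ : z ∈ (range γ)ᶜ := by rw [hun]; simp [hz, hzA]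
      simp only [hg, if_neg hzA]
      linear_combination hconst z hzJ
  have hlog : HasLogOn (fun z => (z - b) / (z - a)) {z | z ≠ a ∧ z ≠ b} := by
    refine ⟨g, fun z hz => ?_, fun z hz => ?_⟩
    · by_cases hzA : z ∈ A
      · have hzB : z ∈ Bᶜ := fun h => (hAB z hzA h).elim hz.1 hz.2
        have : ContinuousAt (fun z => gA z₀ + gB z₀ - gB z) z :=
          continuousAt_const.sub (hgB.continuousAt (hBc.mem_nhds hzB))
        exact (this.congr (by
          filter_upwards [hBc.mem_nhds hzB] with w hw using (hglue w hw).symm)).continuousWithinAt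
      · have : ContinuousAt gA z := hgA.continuousAt (hAc.mem_nhds hzA)
        refine (this.congr ?_).continuousWithinAt
        filter_upwards [hAc.mem_nhds hzA] with w hw
        exact (if_neg hw).symm
    · by_cases hzA : z ∈ A
      · have hzB : z ∈ Bᶜ := fun h => (hAB z hzA h).elim hz.1 hz.2
        have hza : z - a ≠ 0 := sub_ne_zero.2 hz.1
        have hzb : z - b ≠ 0 := sub_ne_zero.2 hz.2
        rw [hglue z hzB, Complex.exp_sub, Complex.exp_add, ← Complex.exp_add, hexp z₀ hz₀,
          hgB' z hzB]
        field_simp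
      · simp only [hg, if_neg hzA]
        exact hgA' z hzA
  have hr : 0 < ‖a - b‖ / 2 := half_pos (norm_pos_iff.2 (sub_ne_zero.2 hab))
  have hsph : ∀ z ∈ sphere a (‖a - b‖ / 2), z ≠ a ∧ z ≠ b := by
    intro z hz
    rw [mem_sphere, dist_eq_norm] at hz
    refine ⟨?_, ?_⟩
    · rintro rfl
      rw [sub_self, norm_zero] at hz
      exact hr.ne hz
    · rintro rfl
      rw [norm_sub_rev] at hz
      linarith
  have hlogb : HasLogOn (fun z => (a - b) * ((z - b) / (a - b))) (sphere a (‖a - b‖ / 2)) := by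
    refine (HasLogOn.const (sub_ne_zero.2 hab)).mul (.of_norm_sub_one_lt (by fun_prop) ?_)
    intro z hz
    rw [mem_sphere, dist_eq_norm] at hz
    have : (z - b) / (a - b) - 1 = (z - a) / (a - b) := by
      field_simp [sub_ne_zero.2 hab]
      ring
    rw [this, norm_div, hz, div_lt_one (by linarith)]
    linarith
  have hfin : HasLogOn (fun z => (z - a) ^ (-1 : ℤ)) (sphere a (‖a - b‖ / 2)) := by
    refine ((hlog.mono hsph).mul (hlogb.zpow (-1))).congr fun z hz => ?_
    have hza : z - a ≠ 0 := sub_ne_zero.2 (hsph z hz).1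
    have hzb : z - b ≠ 0 := sub_ne_zero.2 (hsph z hz).2
    have hab' : a - b ≠ 0 := sub_ne_zero.2 hab
    simp only [zpow_neg, zpow_one]
    field_simp
  have := HasLogOn.eq_zero_of_sphere hr hfin
  omega

lemma isClosed_range : IsClosed (range γ) := hγ.isCompact_range.isClosed

/-- Up to powers, all the functions `z - p` agree on a Jordan curve modulo exponentials. -/
lemma exists_int_hasLogOn {p q : ℂ} (hp : p ∉ range γ) (hq : q ∉ range γ) :
    (HasLogOn (fun z => z - q) (range γ)) ∨
      ∃ n m : ℤ, n ≠ 0 ∧ HasLogOn (fun z => (z - p) ^ n * (z - q) ^ m) (range γ) := by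
  have hlift : ∀ p ∉ range γ, ∃ l : ℝ → ℂ, ContinuousOn l (Icc 0 1) ∧
      (∀ t ∈ Icc (0 : ℝ) 1, Complex.exp (l t) = γ t - p) ∧
      ∃ k : ℤ, l 1 - l 0 = k * (2 * Real.pi * Complex.I) := by
    intro p hp
    obtain ⟨l, hl, hlf⟩ := exists_continuous_log_comp (f := fun z => z - p) zero_le_one
      hγ.continuous.continuousOn (by fun_prop)
      (by rintro _ ⟨t, -, rfl⟩ h; exact hp ⟨t, sub_eq_zero.1 h⟩)
    refine ⟨l, hl, hlf, Complex.exp_eq_one_iff.1 ?_⟩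
    have h1 : γ 1 = γ 0 := by simpa using hγ.periodic 0
    rw [Complex.exp_sub, hlf 1 (by simp), hlf 0 (by simp), h1]
    exact div_self fun h => hp ⟨0, sub_eq_zero.1 h⟩
  have hdesc : ∀ (f : ℂ → ℂ) (l : ℝ → ℂ), ContinuousOn l (Icc 0 1) →
      (∀ t ∈ Icc (0 : ℝ) 1, Complex.exp (l t) = f (γ t)) → l 1 = l 0 →
      HasLogOn f (range γ) := by
    intro f l hl hlf h01
    rw [hγ.range_eq]
    refine .of_comp hγ.continuous.continuousOn hl hlf fun s hs t ht h => ?_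
    obtain ⟨n, hn⟩ := hγ.exists_int s t h
    have h1 : (n : ℝ) ≤ 1 := by linarith [hs.1, ht.2]
    have h2 : (-1 : ℝ) ≤ n := by linarith [hs.2, ht.1]
    have h3 : n ≤ 1 := by exact_mod_cast h1
    have h4 : -1 ≤ n := by exact_mod_cast h2
    obtain rfl | rfl | rfl : n = 0 ∨ n = 1 ∨ n = -1 := by omega
    · simp [hn]
    · push_cast at hn
      rw [show s = 0 by linarith [hs.1, ht.2], show t = 1 by linarith [hs.1, ht.2], h01]
    · push_cast at hn
      rw [show s = 1 by linarith [hs.2, ht.1], show t = 0 by linarith [hs.2, ht.1], h01]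
  obtain ⟨lp, hlp, hlp', k, hk⟩ := hlift p hp
  obtain ⟨lq, hlq, hlq', j, hj⟩ := hlift q hq
  by_cases hj0 : j = 0
  · left
    refine hdesc _ lq hlq hlq' ?_
    rw [hj0] at hj
    push_cast at hj
    linear_combination hj
  · right
    refine ⟨j, -k, hj0, hdesc _ (fun t => j * lp t + (-k : ℤ) * lq t) ?_ ?_ ?_⟩
    · exact (continuousOn_const.mul hlp).add (continuousOn_const.mul hlq)
    · intro t ht
      rw [Complex.exp_add, Complex.exp_int_mul, Complex.exp_int_mul, hlp' t ht, hlq' t ht]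
    · push_cast
      linear_combination (j : ℂ) * hk - (k : ℂ) * hj

lemma not_disjoint_of_isBounded {D₁ D₂ : Set ℂ} (h₁ : IsOpen D₁) (h₂ : IsOpen D₂)
    (hb₁ : Bornology.IsBounded D₁) (hb₂ : Bornology.IsBounded D₂)
    (hf₁ : frontier D₁ ⊆ range γ) (hf₂ : frontier D₂ ⊆ range γ) {p q : ℂ} (hp : p ∈ D₁)
    (hq : q ∈ D₂) (hpγ : p ∉ range γ) (hqγ : q ∉ range γ) : ¬ Disjoint D₁ D₂ := by
  intro hdisj
  obtain h | ⟨n, m, hn, h⟩ := hγ.exists_int_hasLogOn hpγ hqγ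
  · refine one_ne_zero (HasLogOn.eq_zero_of_frontier_subset (n := 1) (u := fun _ => 1)
      hγ.isClosed_range h₂ hb₂ hf₂ hq continuousOn_const (fun _ _ => one_ne_zero)
      (by simpa using h))
  · have hqc : ∀ z ∈ closure D₁, z - q ≠ 0 := fun z hz h0 => by
      rw [sub_eq_zero.1 h0] at hz
      exact (hdisj.closure_left h₂).le_bot ⟨hz, hq⟩
    refine hn (HasLogOn.eq_zero_of_frontier_subset (u := fun z => (z - q) ^ m)
      hγ.isClosed_range h₁ hb₁ hf₁ hp ?_ (fun z hz => zpow_ne_zero _ (hqc z hz)) h)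
    exact ContinuousOn.zpow₀ (by fun_prop) _ fun z hz => Or.inl (hqc z hz)

/-- A closed set that misses a point of a Jordan curve meets the curve inside an arc. -/
lemma exists_arc {F : Set ℂ} (hF : IsClosed F) (hFγ : F ⊆ range γ) (hne : ¬ range γ ⊆ F) :
    ∃ A : Set ℂ, IsCompact A ∧ F ⊆ A ∧ A ⊆ range γ ∧
      ∀ f : ℂ → ℂ, ContinuousOn f A → (∀ z ∈ A, f z ≠ 0) → HasLogOn f A := by
  obtain ⟨_, ⟨c, rfl⟩, hc⟩ := not_subset.1 hne
  have hnhds : γ ⁻¹' Fᶜ ∈ 𝓝 c := hγ.continuous.continuousAt.preimage_mem_nhds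
    (hF.isOpen_compl.mem_nhds hc)
  obtain ⟨ε, hε, hball⟩ := Metric.mem_nhds_iff.1 hnhds
  set δ := min ε (1 / 2) with hδ
  have hδ0 : 0 < δ := by positivity
  have hδε : δ ≤ ε := min_le_left _ _
  have hδh : δ ≤ 1 / 2 := min_le_right _ _
  refine ⟨γ '' Icc (c + δ) (c + 1 - δ), isCompact_Icc.image hγ.continuous, ?_,
    image_subset_range _ _, fun f hf hf0 => .of_arc (by linarith)
      hγ.continuous.continuousOn (hγ.injOn (by linarith)) hf hf0⟩
  intro z hz
  obtain ⟨t, ht, rfl⟩ : z ∈ γ '' Icc c (c + 1) := by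
    rw [hγ.periodic.image_Icc one_pos c]
    exact hFγ hz
  refine ⟨t, ⟨?_, ?_⟩, rfl⟩
  · by_contra hlt
    refine hball (a := t) ?_ hz
    rw [mem_ball, Real.dist_eq, abs_lt]
    constructor <;> linarith [ht.1, ht.2]
  · by_contra hlt
    refine hball (a := t - 1) ?_ (by rwa [hγ.periodic.sub_eq])
    rw [mem_ball, Real.dist_eq, abs_lt]
    constructor <;> linarith [ht.1, ht.2]

/-- The Jordan curve theorem. -/
theorem exists_jordan_components : ∃ D E : Set ℂ, IsOpen D ∧ IsOpen E ∧ IsConnected D ∧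
    IsConnected E ∧ Bornology.IsBounded D ∧ ¬ Bornology.IsBounded E ∧ Disjoint D E ∧
    D ∪ E = (range γ)ᶜ ∧ frontier D = range γ ∧ frontier E = range γ := by
  set J := range γ with hJ
  have hJc : IsClosed J := hγ.isClosed_range
  have hcopen : ∀ x, IsOpen (connectedComponentIn Jᶜ x) := fun x =>
    hJc.isOpen_compl.connectedComponentIn
  have hcfr : ∀ x, frontier (connectedComponentIn Jᶜ x) ⊆ J :=
    frontier_connectedComponentIn_compl_subset hJc
  have hcdisj : ∀ x y, (connectedComponentIn Jᶜ x ∩ connectedComponentIn Jᶜ y).Nonempty →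
      connectedComponentIn Jᶜ x = connectedComponentIn Jᶜ y := by
    rintro x y ⟨z, hz1, hz2⟩
    rw [connectedComponentIn_eq hz1, connectedComponentIn_eq hz2]
  obtain ⟨R, hR0, hR⟩ : ∃ R : ℝ, 0 < R ∧ J ⊆ closedBall 0 R := by
    obtain ⟨R, hR⟩ := hγ.isCompact_range.isBounded.subset_closedBall 0
    exact ⟨max R 1, by positivity, hR.trans (closedBall_subset_closedBall (le_max_left _ _))⟩
  have hout : {z : ℂ | R < ‖z‖} ⊆ Jᶜ := fun z hz hzK => by
    have := hR hzK
    simp only [mem_closedBall, dist_zero_right] at this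
    exact absurd hz (not_lt.2 this)
  obtain ⟨e, he⟩ : ∃ e : ℂ, R < ‖e‖ := ⟨((R + 1 : ℝ) : ℂ), by
    rw [Complex.norm_real, Real.norm_of_nonneg (by linarith)]; linarith⟩
  set E := connectedComponentIn Jᶜ e with hE
  have heJ : e ∈ Jᶜ := hout he
  have hEout : {z : ℂ | R < ‖z‖} ⊆ E :=
    (isPreconnected_norm_gt hR0).subset_connectedComponentIn he hout
  have hEc : IsConnected E := isConnected_connectedComponentIn_iff.2 heJ
  have hbdd : ∀ x ∉ E, Bornology.IsBounded (connectedComponentIn Jᶜ x) := by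
    intro x hx
    by_cases hxJ : x ∈ Jᶜ
    · refine (isBounded_closedBall (x := (0 : ℂ)) (r := R)).subset fun y hy => ?_
      by_contra hy'
      have hyE : y ∈ E := hEout (by simpa using hy')
      have hm := mem_connectedComponentIn hxJ
      rw [hcdisj x e ⟨y, hy, hyE⟩] at hm
      exact hx hm
    · rw [connectedComponentIn_eq_empty hxJ]
      exact Bornology.isBounded_empty
  obtain ⟨d, hdJ, hdE⟩ : ∃ d ∈ Jᶜ, d ∉ E := by
    by_contra! hcon
    refine hγ.not_isPreconnected_compl ?_
    rw [← hJ, (connectedComponentIn_subset Jᶜ e).antisymm hcon |>.symm]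
    exact isPreconnected_connectedComponentIn
  set D := connectedComponentIn Jᶜ d with hD
  have hDb : Bornology.IsBounded D := hbdd d hdE
  have hDE : Disjoint D E := by
    rw [disjoint_iff_inter_eq_empty, ← not_nonempty_iff_eq_empty]
    intro h
    have hm := mem_connectedComponentIn hdJ
    rw [hcdisj d e h] at hm
    exact hdE hm
  have hun : D ∪ E = Jᶜ := by
    refine (union_subset (connectedComponentIn_subset _ _)
      (connectedComponentIn_subset _ _)).antisymm
      fun x hx => ?_
    by_contra hxDE
    rw [mem_union, not_or] at hxDE
    refine hγ.not_disjoint_of_isBounded (hcopen d) (hcopen x) hDb (hbdd x hxDE.2) (hcfr d) (hcfr x)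
      (mem_connectedComponentIn hdJ) (mem_connectedComponentIn hx) hdJ hx ?_
    rw [disjoint_iff_inter_eq_empty, ← not_nonempty_iff_eq_empty]
    intro h
    have hm := mem_connectedComponentIn hx
    rw [← hcdisj d x h] at hm
    exact hxDE.1 hm
  refine ⟨D, E, hcopen d, hcopen e, isConnected_connectedComponentIn_iff.2 hdJ, hEc, hDb, ?_, hDE,
    hun, (hcfr d).antisymm ?_, (hcfr e).antisymm ?_⟩
  · intro hb
    obtain ⟨M, hM⟩ := hb.subset_closedBall 0
    have hmem : ((max R M + 1 : ℝ) : ℂ) ∈ E := hEout (by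
      rw [mem_ofPred_eq, Complex.norm_real, Real.norm_of_nonneg (by positivity)]
      linarith [le_max_left R M])
    have := hM hmem
    rw [mem_closedBall, dist_zero_right, Complex.norm_real,
      Real.norm_of_nonneg (by positivity)] at this
    linarith [le_max_right R M]
  · by_contra hne
    obtain ⟨A, hA, hFA, hAJ, hlog⟩ := hγ.exists_arc isClosed_frontier (hcfr d) hne
    have hdA : ∀ z ∈ A, z - d ≠ 0 := fun z hz h0 => hdJ (hAJ (sub_eq_zero.1 h0 ▸ hz))
    exact one_ne_zero (HasLogOn.eq_zero_of_frontier_subset (n := 1) (u := fun _ => 1)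
      hA.isClosed (hcopen d) hDb hFA (mem_connectedComponentIn hdJ) continuousOn_const
      (fun _ _ => one_ne_zero) (by simpa using hlog (fun z => z - d) (by fun_prop) hdA))
  · by_contra hne
    obtain ⟨A, hA, hFA, hAJ, hlog⟩ := hγ.exists_arc isClosed_frontier (hcfr e) hne
    have hpre : IsPreconnected Aᶜ := isPreconnected_compl_of_hasLogOn hA fun p hp =>
      hlog _ (by fun_prop) fun z hz h0 => hp (sub_eq_zero.1 h0 ▸ hz)
    have hsub : Aᶜ ⊆ E := by
      refine hpre.subset_left_of_subset_union (hcopen e) isClosed_closure.isOpen_compl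
        (disjoint_compl_right.mono_left subset_closure) (fun z hz => ?_) ⟨e, fun h => heJ (hAJ h),
          mem_connectedComponentIn heJ⟩
      by_cases hzE : z ∈ E
      · exact Or.inl hzE
      · refine Or.inr fun hzc => hz (hFA ?_)
        rw [(hcopen e).frontier_eq]
        exact ⟨hzc, hzE⟩
    exact hdE (hsub fun h => hdJ (hAJ h))

end IsJordanParam

lemma HasLogOn.of_mem_slitPlane {X : Type*} [TopologicalSpace X] {f : X → ℂ} {s : Set X}
    (hf : ContinuousOn f s) (h : ∀ x ∈ s, f x ∈ Complex.slitPlane) : HasLogOn f s :=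
  ⟨fun x => Complex.log (f x), hf.clog h, fun x hx =>
    Complex.exp_log (Complex.slitPlane_ne_zero (h x hx))⟩

lemma hasLogOn_sub_of_forall_norm_lt {s : Set ℂ} {p q : ℂ} (hpq : p ≠ q)
    (h : ∀ z ∈ s, ‖z - q‖ < ‖p - q‖) : HasLogOn (fun z => z - p) s := by
  have hqp : q - p ≠ 0 := sub_ne_zero.2 hpq.symm
  refine ((HasLogOn.const (s := s) hqp).mul
    (.of_norm_sub_one_lt (f := fun z => (z - p) / (q - p)) (by fun_prop) fun z hz => ?_)).congr
    fun z _ => mul_div_cancel₀ _ hqp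
  have : (z - p) / (q - p) - 1 = (z - q) / (q - p) := by
    field_simp
    ring
  rw [this, norm_div, norm_sub_rev q, div_lt_one (norm_pos_iff.2 (sub_ne_zero.2 hpq))]
  exact h z hz

lemma hasLogOn_sub_of_isPreconnected_compl {K : Set ℂ} (hK : IsCompact K)
    (hKc : IsPreconnected Kᶜ) {p : ℂ} (hp : p ∉ K) : HasLogOn (fun z => z - p) K := by
  obtain ⟨R, hR0, hR⟩ : ∃ R : ℝ, 0 < R ∧ K ⊆ closedBall 0 R := by
    obtain ⟨R, hR⟩ := hK.isBounded.subset_closedBall 0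
    exact ⟨max R 1, by positivity, hR.trans (closedBall_subset_closedBall (le_max_left _ _))⟩
  obtain ⟨e, he⟩ : ∃ e : ℂ, R < ‖e‖ := ⟨((R + 1 : ℝ) : ℂ), by
    rw [Complex.norm_real, Real.norm_of_nonneg (by linarith)]; linarith⟩
  have heK : e ∈ Kᶜ := fun h => by
    have := hR h
    rw [mem_closedBall, dist_zero_right] at this
    linarith
  have hne : ∀ {x z : ℂ}, x ∈ Kᶜ → z ∈ K → z - x ≠ 0 := fun hx hz h =>
    hx (sub_eq_zero.1 h ▸ hz)
  have hlog_e : HasLogOn (fun z => z - e) K := by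
    refine hasLogOn_sub_of_forall_norm_lt (q := 0) ?_ fun z hz => ?_
    · rintro rfl
      rw [norm_zero] at he
      linarith
    · have := hR hz
      rw [mem_closedBall, dist_zero_right] at this
      simp only [sub_zero]
      linarith
  have key : HasLogOn (fun z => (z - p) / (z - e)) K := by
    refine hKc.induction₂ (fun x y => HasLogOn (fun z => (z - x) / (z - y)) K) ?_ ?_ ?_ hp heK
    · intro x hx
      obtain ⟨r, hr, hball⟩ := Metric.isOpen_iff.1 hK.isClosed.isOpen_compl x hx
      filter_upwards [mem_nhdsWithin_of_mem_nhds (ball_mem_nhds x (half_pos hr)),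
        self_mem_nhdsWithin] with y hy hyK
      refine .of_norm_sub_one_lt ?_ fun z hz => ?_
      · exact ContinuousOn.div (by fun_prop) (by fun_prop) fun z hz => hne hyK hz
      · have : (z - x) / (z - y) - 1 = (y - x) / (z - y) := by
          field_simp [hne hyK hz]
          ring
        rw [mem_ball, dist_eq_norm] at hy
        have hzx : r ≤ ‖z - x‖ := by
          by_contra! h
          exact hball (by rwa [mem_ball, dist_eq_norm]) hz
        have h3 : ‖z - x‖ ≤ ‖z - y‖ + ‖y - x‖ := by
          simpa using norm_add_le (z - y) (y - x)
        rw [this, norm_div, div_lt_one (by linarith)]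
        linarith
    · intro x y w hx hy hw h1 h2
      refine (h1.mul h2).congr fun z hz => ?_
      have := hne hy hz
      have := hne hw hz
      simp only
      field_simp
    · intro x y hx hy h
      refine (h.zpow (-1)).congr fun z hz => ?_
      simp only [zpow_neg, zpow_one, inv_div]
  refine (key.mul hlog_e).congr fun z hz => ?_
  have := hne heK hz
  simp only
  field_simp

/-- Near a nondegenerate zero `p`, a map of the plane is `(z - p) ^ (± 1)` modulo exponentials. -/
lemma exists_hasLogOn_of_hasFDerivAt {Q : ℂ → ℂ} (hQ : Continuous Q) {p : ℂ} {L : ℂ →L[ℝ] ℂ}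
    (hL : HasFDerivAt Q L p) (hdet : L.det ≠ 0) (hp : Q p = 0) :
    ∃ n : ℤ, ∃ r > 0, HasLogOn (fun z => Q z * (z - p) ^ n) (ball p r \ {p}) := by
  have hinj : Function.Injective L := (LinearMap.equivOfDetNeZero (L : ℂ →ₗ[ℝ] ℂ) hdet).injective
  set a : ℂ := (L 1 - Complex.I * L Complex.I) / 2 with ha
  set b : ℂ := (L 1 + Complex.I * L Complex.I) / 2 with hb
  have hLab : ∀ z, L z = a * z + b * (starRingEnd ℂ) z := by
    intro z
    have h1 : L z = z.re * L 1 + z.im * L Complex.I := by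
      have : z = z.re • (1 : ℂ) + z.im • Complex.I := by
        simp [Complex.re_add_im]
      conv_lhs => rw [this, map_add, map_smul, map_smul]
      simp
    have h2 : (z.re : ℂ) + z.im * Complex.I = z := Complex.re_add_im z
    have h3 : (starRingEnd ℂ) z = z.re - z.im * Complex.I := by
      apply Complex.ext <;> simp
    rw [h1, h3, ha, hb]
    conv_rhs => rw [← h2]
    simp only [Complex.add_re, Complex.add_im, Complex.ofReal_re, Complex.ofReal_im, Complex.mul_re,
      Complex.mul_im, Complex.I_re, Complex.I_im]
    push_cast
    linear_combination ((z.im : ℂ) * L Complex.I) * Complex.I_sq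
  have hne : ‖a‖ ≠ ‖b‖ := by
    intro hab
    by_cases ha0 : a = 0
    · have hb0 : b = 0 := by rw [← norm_eq_zero, ← hab, ha0, norm_zero]
      have h1 : L 1 = L 0 := by rw [hLab, hLab]; simp [ha0, hb0]
      exact one_ne_zero (hinj h1)
    · obtain ⟨w, hw⟩ := IsAlgClosed.exists_pow_nat_eq (-b / a) two_pos
      have hwn : ‖w‖ = 1 := by
        have : ‖w‖ ^ 2 = 1 := by
          rw [← norm_pow, hw, norm_div, norm_neg, ← hab, div_self (norm_ne_zero_iff.2 ha0)]
        nlinarith [norm_nonneg w]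
      have hwc : w * (starRingEnd ℂ) w = 1 := by
        rw [Complex.mul_conj, Complex.normSq_eq_norm_sq, hwn]; simp
      have hw0 : w ≠ 0 := fun h => by simp [h] at hwn
      have h1 : L w = L 0 := by
        rw [hLab, hLab, map_zero, mul_zero, mul_zero, add_zero]
        have h2 : w ^ 2 * a = -b := by rw [hw]; field_simp
        apply mul_left_cancel₀ hw0
        linear_combination h2 + b * hwc
      exact hw0 (hinj h1)
  have hδ : 0 < |‖a‖ - ‖b‖| / 2 := half_pos (abs_pos.2 (sub_ne_zero.2 hne))
  obtain ⟨r, hr, hball⟩ := Metric.eventually_nhds_iff_ball.1 (hL.isLittleO.def hδ)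
  have hest : ∀ z ∈ ball p r, ‖Q z - a * (z - p) - b * (starRingEnd ℂ) (z - p)‖
      ≤ |‖a‖ - ‖b‖| / 2 * ‖z - p‖ := by
    intro z hz
    have := hball z hz
    rwa [hp, sub_zero, hLab, ← sub_sub] at this
  have hc : Continuous fun z => (starRingEnd ℂ) (z - p) :=
    Complex.continuous_conj.comp (by fun_prop)
  rcases hne.lt_or_gt with hlt | hlt
  · have hb0 : b ≠ 0 := norm_pos_iff.1 ((norm_nonneg a).trans_lt hlt)
    refine ⟨1, r, hr, ?_⟩
    have h1 : HasLogOn (fun z => Q z / (b * (starRingEnd ℂ) (z - p))) (ball p r \ {p}) := by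
      have hne0 : ∀ z ∈ ball p r \ {p}, b * (starRingEnd ℂ) (z - p) ≠ 0 := fun z hz =>
        mul_ne_zero hb0 ((map_ne_zero _).2 (sub_ne_zero.2 hz.2))
      refine .of_norm_sub_one_lt (hQ.continuousOn.div (continuous_const.mul hc).continuousOn hne0)
        fun z hz => ?_
      have hzp : 0 < ‖z - p‖ := norm_pos_iff.2 (sub_ne_zero.2 hz.2)
      rw [div_sub_one (hne0 z hz), norm_div, norm_mul, RCLike.norm_conj, div_lt_one (by positivity)]
      have h2 := hest z hz.1
      rw [abs_of_neg (by linarith)] at h2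
      have h3 : ‖Q z - b * (starRingEnd ℂ) (z - p)‖ ≤
          ‖Q z - a * (z - p) - b * (starRingEnd ℂ) (z - p)‖ + ‖a * (z - p)‖ := by
        refine le_trans (le_of_eq ?_) (norm_add_le _ _)
        congr 1
        ring
      rw [norm_mul a] at h3
      nlinarith
    have h2 : HasLogOn (fun z => (z - p) * (starRingEnd ℂ) (z - p)) (ball p r \ {p}) := by
      refine .of_mem_slitPlane (by fun_prop) fun z hz => ?_
      rw [Complex.mul_conj, Complex.ofReal_mem_slitPlane, Complex.normSq_pos]
      exact sub_ne_zero.2 hz.2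
    refine ((h1.mul h2).mul (.const hb0)).congr fun z hz => ?_
    have : (starRingEnd ℂ) (z - p) ≠ 0 := (map_ne_zero _).2 (sub_ne_zero.2 hz.2)
    simp only [zpow_one]
    field_simp
  · have ha0 : a ≠ 0 := norm_pos_iff.1 ((norm_nonneg b).trans_lt hlt)
    refine ⟨-1, r, hr, ?_⟩
    have h1 : HasLogOn (fun z => Q z / (a * (z - p))) (ball p r \ {p}) := by
      have hne0 : ∀ z ∈ ball p r \ {p}, a * (z - p) ≠ 0 := fun z hz =>
        mul_ne_zero ha0 (sub_ne_zero.2 hz.2)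
      refine .of_norm_sub_one_lt (hQ.continuousOn.div (by fun_prop) hne0)
        fun z hz => ?_
      have hzp : 0 < ‖z - p‖ := norm_pos_iff.2 (sub_ne_zero.2 hz.2)
      rw [div_sub_one (hne0 z hz), norm_div, norm_mul, div_lt_one (by positivity)]
      have h2 := hest z hz.1
      rw [abs_of_pos (by linarith)] at h2
      have h3 : ‖Q z - a * (z - p)‖ ≤
          ‖Q z - a * (z - p) - b * (starRingEnd ℂ) (z - p)‖ + ‖b * (starRingEnd ℂ) (z - p)‖ := by
        refine le_trans (le_of_eq ?_) (norm_add_le _ _)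
        congr 1
        ring
      rw [norm_mul b, RCLike.norm_conj] at h3
      nlinarith
    refine (h1.mul (.const ha0)).congr fun z hz => ?_
    have : z - p ≠ 0 := sub_ne_zero.2 hz.2
    simp only [zpow_neg, zpow_one]
    field_simp

lemma hasLogOn_of_finite {K : Set ℂ} (hK : IsClosed K) {S : Set ℂ} (hS : S.Finite) :
    ∀ Q : ℂ → ℂ, ContinuousOn Q Sᶜ → (∀ z ∈ Sᶜ, Q z ≠ 0) →
      (∀ p ∈ S, ∃ n : ℤ, ∃ r > 0, HasLogOn (fun z => Q z * (z - p) ^ n) (ball p r \ {p})) →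
      (∀ p ∈ S, p ∉ K ∧ HasLogOn (fun z => z - p) K) → HasLogOn Q K := by
  classical
  induction S, hS using Set.Finite.induction_on with
  | empty =>
    intro Q hQ hQ0 _ _
    rw [compl_empty] at hQ hQ0
    exact (HasLogOn.of_contractible (continuousOn_univ.1 hQ) fun z => hQ0 z trivial).mono
      (subset_univ K)
  | @insert p S hpS hS ih =>
    intro Q hQ hQ0 hloc hlog
    obtain ⟨n, r₀, hr₀, g, hg, hgQ⟩ := hloc p (mem_insert _ _)
    obtain ⟨r₁, hr₁, hball⟩ := Metric.isOpen_iff.1 (hS.isClosed.union hK).isOpen_compl p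
      (fun h => h.elim hpS (hlog p (mem_insert _ _)).1)
    obtain ⟨r, hr, hrr₀, hrr₁⟩ : ∃ r > 0, r ≤ r₀ ∧ r ≤ r₁ :=
      ⟨min r₀ r₁, lt_min hr₀ hr₁, min_le_left _ _, min_le_right _ _⟩
    set χ : ℂ → ℝ := fun z => min 1 (max 0 (4 * ‖z - p‖ / r - 1)) with hχ
    have hχc : Continuous χ := by fun_prop
    have hχ0 : ∀ z ∈ ball p (r / 4), χ z = 0 := by
      intro z hz
      rw [mem_ball, dist_eq_norm] at hz
      have : 4 * ‖z - p‖ / r - 1 ≤ 0 := by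
        rw [sub_nonpos, div_le_one hr]; linarith
      simp [hχ, max_eq_left this]
    have hχ1 : ∀ z, r / 2 < ‖z - p‖ → χ z = 1 := by
      intro z hz
      have : 1 ≤ 4 * ‖z - p‖ / r - 1 := by
        rw [le_sub_iff_add_le, le_div_iff₀ hr]; linarith
      simp [hχ, this]
    set Q' : ℂ → ℂ := fun z => if z ∈ ball p r then Complex.exp (χ z * g z) else Q z * (z - p) ^ n
      with hQ'
    have hout : ∀ z, r / 2 < ‖z - p‖ → Q' z = Q z * (z - p) ^ n := by
      intro z hz
      by_cases hzr : z ∈ ball p r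
      · have hzp : z ≠ p := by
          rintro rfl
          rw [sub_self, norm_zero] at hz
          linarith
        rw [hQ']
        simp only [if_pos hzr]
        rw [hχ1 z hz, Complex.ofReal_one, one_mul, hgQ z ⟨ball_subset_ball hrr₀ hzr, hzp⟩]
      · rw [hQ']
        simp only [if_neg hzr]
    have hopen : IsOpen {z : ℂ | r / 2 < ‖z - p‖} := isOpen_lt continuous_const (by fun_prop)
    have hχg : ContinuousOn (fun z => χ z * g z) (ball p r) := by
      intro z hz
      by_cases hzp : z = p
      · subst hzp
        have : ContinuousAt (fun _ : ℂ => (0 : ℂ)) z := continuousAt_const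
        refine (this.congr ?_).continuousWithinAt
        filter_upwards [ball_mem_nhds z (by positivity : 0 < r / 4)] with w hw
        rw [hχ0 w hw, Complex.ofReal_zero, zero_mul]
      · have hmem : ball p r₀ \ {p} ∈ 𝓝 z := (isOpen_ball.sdiff isClosed_singleton).mem_nhds
          ⟨ball_subset_ball hrr₀ hz, hzp⟩
        exact ((Complex.continuous_ofReal.comp hχc).continuousAt.mul
          (hg.continuousAt hmem)).continuousWithinAt
    have hins : ∀ z ∉ S, r / 2 < ‖z - p‖ → z ∈ (insert p S)ᶜ := by
      rintro z hz hzp (rfl | h)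
      · rw [sub_self, norm_zero] at hzp
        linarith
      · exact hz h
    have hcases : ∀ z, z ∈ ball p r ∨ r / 2 < ‖z - p‖ := by
      intro z
      rw [mem_ball, dist_eq_norm]
      rcases lt_or_ge ‖z - p‖ r with h | h
      · exact Or.inl h
      · exact Or.inr (by linarith)
    have hfar : ∀ z ∈ S ∪ K, r ≤ ‖z - p‖ := by
      intro z hz
      by_contra! h
      exact hball (ball_subset_ball hrr₁ (by rwa [mem_ball, dist_eq_norm])) hz
    have key : HasLogOn Q' K := by
      refine ih Q' ?_ ?_ ?_ fun q hq => hlog q (mem_insert_of_mem _ hq)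
      · intro z hz
        rcases hcases z with h | h
        · have : ContinuousAt (fun z => Complex.exp (χ z * g z)) z :=
            (hχg.continuousAt (isOpen_ball.mem_nhds h)).cexp
          refine (this.congr ?_).continuousWithinAt
          filter_upwards [isOpen_ball.mem_nhds h] with w hw using (if_pos hw).symm
        · have hz' := hins z hz h
          have hzp : z - p ≠ 0 := fun h0 => hz' (Or.inl (sub_eq_zero.1 h0))
          have h1 : ContinuousAt Q z :=
            hQ.continuousAt ((hS.insert p).isClosed.isOpen_compl.mem_nhds hz')
          have h2 : ContinuousAt (fun z => (z - p) ^ n) z :=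
            ContinuousAt.zpow₀ (by fun_prop) _ (Or.inl hzp)
          refine ((h1.mul h2).congr ?_).continuousWithinAt
          filter_upwards [hopen.mem_nhds h] with w hw using (hout w hw).symm
      · intro z hz
        rcases hcases z with h | h
        · simp only [hQ', if_pos h]
          exact Complex.exp_ne_zero _
        · have hz' := hins z hz h
          rw [hout z h]
          exact mul_ne_zero (hQ0 z hz')
            (zpow_ne_zero _ fun h0 => hz' (Or.inl (sub_eq_zero.1 h0)))
      · intro q hq
        obtain ⟨m, ρ, hρ, hlogq⟩ := hloc q (mem_insert_of_mem _ hq)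
        have hqr := hfar q (Or.inl hq)
        have hnear : ∀ z ∈ ball q (min ρ (r / 2)), ‖z - q‖ < ρ ∧ ‖z - q‖ < r / 2 := by
          intro z hz
          rwa [mem_ball, dist_eq_norm, lt_min_iff] at hz
        refine ⟨m, min ρ (r / 2), by positivity, ?_⟩
        have h1 : HasLogOn (fun z => z - p) (ball q (min ρ (r / 2)) \ {q}) := by
          refine hasLogOn_sub_of_forall_norm_lt (q := q) (fun h => hpS (h ▸ hq)) fun z hz => ?_
          rw [norm_sub_rev p]
          linarith [(hnear z hz.1).2]
        refine ((hlogq.mono (sdiff_subset_sdiff_left (ball_subset_ball (min_le_left _ _)))).mul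
          (h1.zpow n)).congr fun z hz => ?_
        have : r / 2 < ‖z - p‖ := by
          have h3 : ‖q - p‖ ≤ ‖q - z‖ + ‖z - p‖ := by simpa using norm_add_le (q - z) (z - p)
          rw [norm_sub_rev q z] at h3
          linarith [(hnear z hz.1).2]
        simp only [hout z this]
        ring
    refine (key.mul ((hlog p (mem_insert _ _)).2.zpow (-n))).congr fun z hz => ?_
    have h1 := hfar z (Or.inr hz)
    have h2 : z - p ≠ 0 := norm_pos_iff.1 (by linarith)
    simp only [hout z (by linarith), zpow_neg]
    rw [mul_assoc, mul_inv_cancel₀ (zpow_ne_zero _ h2), mul_one]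

lemma exists_regular_value {P : ℂ → ℂ} (hP : Differentiable ℝ P) {ε : ℝ} (hε : 0 < ε) :
    ∃ c : ℂ, c ≠ 0 ∧ ‖c‖ < ε ∧ ∀ z, P z = c → (fderiv ℝ P z).det ≠ 0 := by
  have h0 : MeasureTheory.volume (P '' {z | (fderiv ℝ P z).det = 0} ∪ {0}) = 0 := by
    refine MeasureTheory.measure_union_null ?_ (MeasureTheory.measure_singleton _)
    exact MeasureTheory.addHaar_image_eq_zero_of_det_fderivWithin_eq_zero _
      (fun z _ => (hP z).hasFDerivAt.hasFDerivWithinAt) fun z hz => hz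
  obtain ⟨c, hc, hcn⟩ : ∃ c ∈ ball (0 : ℂ) ε, c ∉ P '' {z | (fderiv ℝ P z).det = 0} ∪ {0} := by
    by_contra! hcon
    exact isOpen_ball.measure_ne_zero MeasureTheory.volume ⟨0, mem_ball_self hε⟩
      (MeasureTheory.measure_mono_null hcon h0)
  exact ⟨c, fun h => hcn (Or.inr h), by simpa using hc, fun z hz hdet => hcn (Or.inl ⟨z, hdet, hz⟩)⟩

/-- A nonvanishing holomorphic function on a neighbourhood of a compact set that does not separate
the plane has a continuous logarithm there. -/
lemma HasLogOn.of_differentiableOn {K D : Set ℂ} (hK : IsCompact K) (hKc : IsPreconnected Kᶜ)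
    (hD : IsOpen D) (hDb : Bornology.IsBounded D) (hKD : K ⊆ D) {f : ℂ → ℂ}
    (hf : DifferentiableOn ℂ f D) (hf0 : ∀ z ∈ D, f z ≠ 0) : HasLogOn f K := by
  obtain ⟨φ, hφ0, hφ1, -⟩ := exists_contMDiffMap_zero_one_nhds_of_isClosed (n := 1)
    (modelWithCornersSelf ℝ ℂ) hD.isClosed_compl hK.isClosed (disjoint_compl_left_iff_subset.2 hKD)
  have hφd : ContDiff ℝ 1 φ := φ.contMDiff.contDiff
  rw [eventually_nhdsSet_iff_forall] at hφ0
  have hφK : ∀ z ∈ K, φ z = 1 := fun z hz => hφ1.self_of_nhdsSet z hz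
  set P : ℂ → ℂ := fun z => φ z * f z with hP
  have hPd : Differentiable ℝ P := by
    intro z
    by_cases hz : z ∈ D
    · have h1 : DifferentiableAt ℝ f z :=
        (hf.differentiableAt (hD.mem_nhds hz)).restrictScalars ℝ
      have h2 : DifferentiableAt ℝ (fun z => (φ z : ℂ)) z :=
        Complex.ofRealCLM.differentiableAt.comp z (hφd.differentiable one_ne_zero z)
      exact h2.mul h1
    · refine (differentiableAt_const (0 : ℂ)).congr_of_eventuallyEq ?_
      filter_upwards [hφ0 z hz] with w hw
      simp [hP, hw]
  have hfK : ContinuousOn f K := hf.continuousOn.mono hKD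
  obtain ⟨ε, hε, hεf⟩ := hK.exists_forall_le' (f := fun z => ‖f z‖) (a := 0) hfK.norm
    fun z hz => norm_pos_iff.2 (hf0 z (hKD hz))
  obtain ⟨c, hc0, hcε, hreg⟩ := exists_regular_value hPd hε
  have hQc : Continuous fun z => P z - c := hPd.continuous.sub continuous_const
  have hloc : ∀ p, P p = c → ∃ n : ℤ, ∃ r > 0,
      HasLogOn (fun z => (P z - c) * (z - p) ^ n) (ball p r \ {p}) := fun p hp =>
    exists_hasLogOn_of_hasFDerivAt hQc ((hPd p).hasFDerivAt.sub_const c) (hreg p hp)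
      (sub_eq_zero.2 hp)
  have hfin : {z | P z = c}.Finite := by
    have hcomp : IsCompact {z | P z = c} := by
      refine Metric.isCompact_of_isClosed_isBounded (isClosed_eq hPd.continuous continuous_const)
        (hDb.subset fun z hz => ?_)
      by_contra hzD
      have : P z = 0 := by simp [hP, (hφ0 z hzD).self_of_nhds]
      exact hc0 (hz.symm.trans this)
    refine hcomp.finite (isDiscrete_iff_forall_mem_exists_isOpen.2 fun p hp => ?_)
    obtain ⟨n, r, hr, g, -, hg⟩ := hloc p hp
    refine ⟨ball p r, isOpen_ball, Subset.antisymm (fun z hz => ?_) (fun z hz => ?_)⟩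
    · by_contra hzp
      have := hg z ⟨hz.1, hzp⟩
      simp only [sub_eq_zero.2 hz.2, zero_mul] at this
      exact Complex.exp_ne_zero _ this
    · rw [mem_singleton_iff.1 hz]
      exact ⟨mem_ball_self hr, hp⟩
  have hPK : ∀ z ∈ K, P z = f z := fun z hz => by simp [hP, hφK z hz]
  have h1 : HasLogOn (fun z => P z - c) K := by
    refine hasLogOn_of_finite hK.isClosed hfin _ hQc.continuousOn (fun z hz => sub_ne_zero.2 hz)
      hloc fun p hp => ?_
    have hpK : p ∉ K := fun h => by
      have h2 := hεf p h
      rw [← hPK p h, show P p = c from hp] at h2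
      linarith
    exact ⟨hpK, hasLogOn_sub_of_isPreconnected_compl hK hKc hpK⟩
  have h2 : HasLogOn (fun z => (f z - c) / f z) K := by
    refine .of_norm_sub_one_lt ((hfK.sub continuousOn_const).div hfK fun z hz => hf0 z (hKD hz))
      fun z hz => ?_
    have h3 := hf0 z (hKD hz)
    rw [div_sub_one h3, sub_sub_cancel_left, norm_div, norm_neg, div_lt_one (norm_pos_iff.2 h3)]
    exact hcε.trans_le (hεf z hz)
  refine (h1.mul (h2.zpow (-1))).congr fun z hz => ?_
  have h3 := hf0 z (hKD hz)
  have h4 : f z - c ≠ 0 := fun h => by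
    have := hεf z hz
    simp only [sub_eq_zero.1 h] at this
    linarith
  simp only [zpow_neg, zpow_one, hPK z hz]
  field_simp

lemma isPreconnected_thickening {s : Set ℂ} (hs : IsPreconnected s) (δ : ℝ) :
    IsPreconnected (thickening δ s) := by
  rw [← add_ball_zero, ← image2_add, ← image_prod]
  exact (hs.prod (convex_ball _ _).isPreconnected).image _ (by fun_prop)

/-- A compact set that does not separate the plane, exhausting `D` as `δ → 0`. -/
lemma isCompact_compl_thickening {D : Set ℂ} (hD : Bornology.IsBounded D) {δ : ℝ} (hδ : 0 < δ) :
    IsCompact (thickening δ Dᶜ)ᶜ :=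
  Metric.isCompact_of_isClosed_isBounded isOpen_thickening.isClosed_compl
    (hD.subset (compl_subset_comm.1 (self_subset_thickening hδ _)))

theorem hasLogOn_of_isPreconnected_compl {D : Set ℂ} (hD : IsOpen D) (hDb : Bornology.IsBounded D)
    (hDc : IsConnected D) (hDc' : IsPreconnected Dᶜ) {f : ℂ → ℂ}
    (hf : DifferentiableOn ℂ f D) (hf0 : ∀ z ∈ D, f z ≠ 0) : HasLogOn f D := by
  obtain ⟨p, hp⟩ := hDc.nonempty
  set δ : ℕ → ℝ := fun n => 1 / (n + 1) with hδ
  have hδ0 : ∀ n, 0 < δ n := fun n => Nat.one_div_pos_of_nat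
  set K : ℕ → Set ℂ := fun n => (thickening (δ n) Dᶜ)ᶜ with hK
  have hKD : ∀ n, K n ⊆ D := fun n => compl_subset_comm.1 (self_subset_thickening (hδ0 n) _)
  have hlog : ∀ n, HasLogOn f (K n) := fun n =>
    .of_differentiableOn (isCompact_compl_thickening hDb (hδ0 n))
      (by rw [compl_compl]; exact isPreconnected_thickening hDc' _) hD hDb (hKD n) hf hf0
  have hKmono : Monotone K := fun m n hmn =>
    compl_subset_compl.2 (thickening_mono (Nat.one_div_le_one_div hmn) _)
  have hcover : ∀ A ⊆ D, IsCompact A → ∃ n, A ⊆ interior (K n) := by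
    intro A hAD hA
    obtain ⟨ε, hε, hdisj⟩ := (disjoint_compl_right_iff_subset.2 hAD).exists_thickenings hA
      hD.isClosed_compl
    obtain ⟨n, hn⟩ := exists_nat_one_div_lt hε
    refine ⟨n, ?_⟩
    refine (self_subset_thickening hε A).trans (interior_maximal ?_ isOpen_thickening)
    exact fun z hz hz' => hdisj.le_bot ⟨hz, thickening_mono hn.le _ hz'⟩
  set W : ℕ → Set ℂ := fun n => connectedComponentIn (interior (K n)) p with hW
  have hWK : ∀ n, W n ⊆ K n := fun n => (connectedComponentIn_subset _ _).trans interior_subset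
  have hWo : ∀ n, IsOpen (W n) := fun n => isOpen_interior.connectedComponentIn
  have hWmono : Monotone W := fun m n hmn =>
    connectedComponentIn_mono _ (interior_mono (hKmono hmn))
  have hWcover : ∀ z ∈ D, ∃ n, z ∈ W n ∧ p ∈ W n := by
    intro z hz
    obtain ⟨γ, hγ⟩ := (hD.isConnected_iff_isPathConnected.1 hDc).joinedIn p hp z hz
    obtain ⟨n, hn⟩ := hcover (range γ) (range_subset_iff.2 hγ) (isCompact_range γ.continuous)
    have hsub : range γ ⊆ W n :=
      (isPreconnected_range γ.continuous).subset_connectedComponentIn ⟨0, γ.source⟩ hn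
    exact ⟨n, hsub ⟨1, γ.target⟩, hsub ⟨0, γ.source⟩⟩
  choose g hg hgf using fun n => (hlog n).mono (hWK n)
  have hagree : ∀ m n, m ≤ n → p ∈ W m → ∀ z ∈ W m, g m z - g m p = g n z - g n p := by
    intro m n hmn hpm z hz
    have := eqOn_of_exp_eq_one (s := W m) isPreconnected_connectedComponentIn
      (g := fun z => g m z - g n z) ((hg m).sub ((hg n).mono (hWmono hmn))) (fun x hx => by
        rw [Complex.exp_sub, hgf m x hx, hgf n x (hWmono hmn hx),
          div_self (hf0 x (hKD m (hWK m hx)))]) hz hpm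
    linear_combination this
  choose! N hN hNp using hWcover
  have hglue : ∀ z ∈ D, ∀ n, z ∈ W n → p ∈ W n → g (N z) z - g (N z) p = g n z - g n p := by
    intro z hz n hzn hpn
    rcases le_total (N z) n with h | h
    · exact hagree _ _ h (hNp z hz) z (hN z hz)
    · exact (hagree _ _ h hpn z hzn).symm
  refine ⟨fun z => g (N z) z - g (N z) p + Complex.log (f p), fun z hz => ?_, fun z hz => ?_⟩
  · have h1 : ContinuousAt (fun w => g (N z) w - g (N z) p + Complex.log (f p)) z :=
      (((hg (N z)).continuousAt ((hWo _).mem_nhds (hN z hz))).sub continuousAt_const).add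
        continuousAt_const
    refine (h1.congr ?_).continuousWithinAt
    filter_upwards [(hWo _).mem_nhds (hN z hz)] with w hw
    rw [hglue w (hKD _ (hWK _ hw)) _ hw (hNp z hz)]
  · rw [Complex.exp_add, Complex.exp_sub, hgf _ z (hN z hz), hgf _ p (hNp z hz),
      Complex.exp_log (hf0 p hp), div_mul_cancel₀ _ (hf0 p hp)]

lemma HasLogOn.exists_differentiableOn {D : Set ℂ} (hD : IsOpen D) {f : ℂ → ℂ}
    (hf : DifferentiableOn ℂ f D) (h : HasLogOn f D) :
    ∃ g : ℂ → ℂ, DifferentiableOn ℂ g D ∧ ∀ z ∈ D, Complex.exp (g z) = f z := by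
  obtain ⟨g, hg, hgf⟩ := h
  refine ⟨g, fun z hz => ?_, hgf⟩
  have hf0 : f z ≠ 0 := hgf z hz ▸ Complex.exp_ne_zero _
  have hfd := hf.differentiableAt (hD.mem_nhds hz)
  have h1 : DifferentiableAt ℂ (fun w => g z + Complex.log (f w / f z)) z := by
    refine ((hfd.div_const _).clog ?_).const_add _
    rw [div_self hf0]
    exact Complex.one_mem_slitPlane
  refine (h1.congr_of_eventuallyEq ?_).differentiableWithinAt
  have hgc : ContinuousAt g z := hg.continuousAt (hD.mem_nhds hz)
  filter_upwards [hgc.eventually (ball_mem_nhds (g z) Real.pi_pos), hD.mem_nhds hz] with w hw hwD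
  have him : |(g w - g z).im| < Real.pi :=
    (Complex.abs_im_le_norm _).trans_lt (by rwa [dist_eq_norm] at hw)
  rw [abs_lt] at him
  rw [← hgf w hwD, ← hgf z hz, ← Complex.exp_sub, Complex.log_exp him.1 him.2.le]
  ring

/-- The disc automorphism sending `c` to `0`. -/
noncomputable def discAut (c z : ℂ) : ℂ := (z - c) / (1 - (starRingEnd ℂ) c * z)

section discAut

variable {c z w : ℂ}

lemma discAut_self : discAut c c = 0 := by simp [discAut]

lemma one_sub_conj_mul_ne_zero (hc : ‖c‖ < 1) (hz : ‖z‖ < 1) : 1 - (starRingEnd ℂ) c * z ≠ 0 := by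
  intro h
  have h1 : ‖(starRingEnd ℂ) c * z‖ = 1 := by rw [← sub_eq_zero.1 h, norm_one]
  rw [norm_mul, RCLike.norm_conj] at h1
  nlinarith [norm_nonneg c, norm_nonneg z]

lemma norm_discAut_lt_one (hc : ‖c‖ < 1) (hz : ‖z‖ < 1) : ‖discAut c z‖ < 1 := by
  have h0 := one_sub_conj_mul_ne_zero hc hz
  rw [discAut, norm_div, div_lt_one (norm_pos_iff.2 h0)]
  refine lt_of_pow_lt_pow_left₀ 2 (norm_nonneg _) ?_
  have h1 : ‖1 - (starRingEnd ℂ) c * z‖ ^ 2 - ‖z - c‖ ^ 2 = (1 - ‖c‖ ^ 2) * (1 - ‖z‖ ^ 2) := by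
    simp only [← Complex.normSq_eq_norm_sq, Complex.normSq_apply, Complex.sub_re, Complex.sub_im,
      Complex.one_re, Complex.one_im, Complex.mul_re, Complex.mul_im, Complex.conj_re,
      Complex.conj_im]
    ring
  have h2 : 0 < 1 - ‖c‖ ^ 2 := by nlinarith [norm_nonneg c]
  have h3 : 0 < 1 - ‖z‖ ^ 2 := by nlinarith [norm_nonneg z]
  nlinarith [mul_pos h2 h3]

lemma one_sub_conj_mul_self (hc : ‖c‖ < 1) : 1 - (starRingEnd ℂ) c * c ≠ 0 :=
  one_sub_conj_mul_ne_zero hc hc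

lemma discAut_injOn (hc : ‖c‖ < 1) (hz : ‖z‖ < 1) (hw : ‖w‖ < 1)
    (h : discAut c z = discAut c w) : z = w := by
  have h1 := one_sub_conj_mul_ne_zero hc hz
  have h2 := one_sub_conj_mul_ne_zero hc hw
  rw [discAut, discAut, div_eq_div_iff h1 h2] at h
  refine sub_eq_zero.1 ((mul_eq_zero.1 ?_).resolve_right (one_sub_conj_mul_self hc))
  linear_combination h

lemma discAut_eq_zero_iff (hc : ‖c‖ < 1) (hz : ‖z‖ < 1) : discAut c z = 0 ↔ z = c := by
  rw [discAut, div_eq_zero_iff, or_iff_left (one_sub_conj_mul_ne_zero hc hz), sub_eq_zero]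

lemma hasDerivAt_discAut (hc : ‖c‖ < 1) (hz : ‖z‖ < 1) : HasDerivAt (discAut c)
    ((1 - (starRingEnd ℂ) c * c) / (1 - (starRingEnd ℂ) c * z) ^ 2) z := by
  have h0 := one_sub_conj_mul_ne_zero hc hz
  have h1 : HasDerivAt (fun z => 1 - (starRingEnd ℂ) c * z) (-(starRingEnd ℂ) c) z := by
    simpa using ((hasDerivAt_id z).const_mul ((starRingEnd ℂ) c)).const_sub 1
  refine (((hasDerivAt_id z).sub_const c).div h1 h0).congr_deriv ?_
  simp only [id]
  congr 1
  ring

end discAut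

/-- The competitors in the extremal problem for the Riemann map of `D` based at `p`. -/
structure IsDiscInjection (D : Set ℂ) (p : ℂ) (f : ℂ → ℂ) : Prop where
  differentiableOn : DifferentiableOn ℂ f D
  injOn : InjOn f D
  norm_lt : ∀ z ∈ D, ‖f z‖ < 1
  map_base : f p = 0

/-- Montel's theorem along an ultrafilter. -/
lemma exists_tendstoLocallyUniformlyOn {ι : Type*} (l : Ultrafilter ι) {D : Set ℂ} (hD : IsOpen D)
    {F : ι → ℂ → ℂ} (hF : ∀ i, DifferentiableOn ℂ (F i) D) (hF1 : ∀ i, ∀ z ∈ D, ‖F i z‖ ≤ 1) :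
    ∃ f : ℂ → ℂ, TendstoLocallyUniformlyOn F f l D := by
  have hlim : ∀ z, ∃ w, z ∈ D → Tendsto (fun i => F i z) l (𝓝 w) := by
    intro z
    by_cases hz : z ∈ D
    · obtain ⟨w, -, hw⟩ := (isCompact_closedBall (0 : ℂ) 1).ultrafilter_le_nhds'
        (l.map fun i => F i z) (by
          refine Ultrafilter.mem_map.2 (univ_mem' fun i => ?_)
          simpa using hF1 i z hz)
      exact ⟨w, fun _ => hw⟩
    · exact ⟨0, fun h => absurd h hz⟩
  choose f hf using hlim
  refine ⟨f, Metric.tendstoLocallyUniformlyOn_iff.2 fun ε hε z hz => ?_⟩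
  obtain ⟨r, hr, hball⟩ := Metric.isOpen_iff.1 hD z hz
  have hlip : ∀ i, ∀ w ∈ ball z r, dist (F i w) (F i z) ≤ 2 / r * dist w z := by
    intro i w hw
    refine Complex.dist_le_div_mul_dist_of_mapsTo_ball ((hF i).mono hball) (fun x hx => ?_) hw
    rw [mem_closedBall]
    calc dist (F i x) (F i z) ≤ ‖F i x‖ + ‖F i z‖ := dist_le_norm_add_norm _ _
      _ ≤ 2 := by linarith [hF1 i x (hball hx), hF1 i z hz]
  have hlip' : ∀ w ∈ ball z r, dist (f w) (f z) ≤ 2 / r * dist w z := fun w hw =>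
    le_of_tendsto ((hf w (hball hw)).dist (hf z hz)) (Eventually.of_forall fun i => hlip i w hw)
  refine ⟨ball z (min r (ε * r / 8)), mem_nhdsWithin_of_mem_nhds (ball_mem_nhds _ (by positivity)),
    ?_⟩
  filter_upwards [(hf z hz).eventually (ball_mem_nhds _ (by positivity : 0 < ε / 4))] with i hi w hw
  rw [mem_ball, lt_min_iff] at hw
  have h1 : 2 / r * dist w z ≤ ε / 4 := by
    rw [div_mul_eq_mul_div, div_le_iff₀ hr]
    linarith [hw.2]
  calc dist (f w) (F i w) ≤ dist (f w) (f z) + dist (f z) (F i z) + dist (F i z) (F i w) :=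
        dist_triangle4 _ _ _ _
    _ < ε := by
      rw [dist_comm (f z) (F i z), dist_comm (F i z) (F i w)]
      have := hlip i w hw.1
      have := hlip' w hw.1
      have : dist (F i z) (f z) < ε / 4 := hi
      linarith

/-- Hurwitz's theorem: a nonconstant locally uniform limit of injective holomorphic functions
is injective. -/
lemma injOn_of_tendstoLocallyUniformlyOn {ι : Type*} {l : Filter ι} [l.NeBot] {D : Set ℂ}
    (hD : IsOpen D) (hDc : IsPreconnected D) {F : ι → ℂ → ℂ} {f : ℂ → ℂ}
    (hF : ∀ i, DifferentiableOn ℂ (F i) D) (hinj : ∀ i, InjOn (F i) D)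
    (hlim : TendstoLocallyUniformlyOn F f l D) (hne : ¬ ∃ c, ∀ z ∈ D, f z = c) : InjOn f D := by
  intro a ha b hb hab
  by_contra hneq
  have hfd : DifferentiableOn ℂ f D := hlim.differentiableOn (Eventually.of_forall hF) hD
  have hfa : AnalyticOnNhd ℂ (fun z => f z - f a) D := (hfd.sub_const _).analyticOnNhd hD
  have hev : ∀ᶠ z in 𝓝[≠] b, f z - f a ≠ 0 := by
    refine (hfa b hb).eventually_eq_zero_or_eventually_ne_zero.resolve_left fun h => hne ⟨f a, ?_⟩
    intro z hz
    have := hfa.eqOn_zero_of_preconnected_of_eventuallyEq_zero hDc hb h hz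
    exact sub_eq_zero.1 this
  rw [eventually_nhdsWithin_iff] at hev
  obtain ⟨r, hr, hball⟩ := Metric.nhds_basis_closedBall.mem_iff.1
    (inter_mem (inter_mem hev (hD.mem_nhds hb)) (isOpen_ne.mem_nhds (Ne.symm hneq)))
  have hsD : sphere b r ⊆ D := fun z hz => (hball (sphere_subset_closedBall hz)).1.2
  have hs0 : ∀ z ∈ sphere b r, 0 < ‖f z - f a‖ := by
    intro z hz
    refine norm_pos_iff.2 ((hball (sphere_subset_closedBall hz)).1.1 ?_)
    rintro rfl
    rw [mem_sphere, dist_self] at hz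
    exact hr.ne hz
  obtain ⟨m, hm, hmf⟩ := (isCompact_sphere b r).exists_forall_le' (f := fun z => ‖f z - f a‖)
    ((hfd.continuousOn.mono hsD).sub continuousOn_const).norm hs0
  have hunif := (tendstoLocallyUniformlyOn_iff_forall_isCompact hD).1 hlim _
    (insert_subset ha (insert_subset hb hsD)) (((isCompact_sphere b r).insert b).insert a)
  obtain ⟨i, hi⟩ := (Metric.tendstoUniformlyOn_iff.1 hunif (m / 8) (by positivity)).exists
  have hia := hi a (by simp)
  have hib := hi b (by simp)
  have hne' : ∀ z ∈ closedBall b r, F i z - F i a ≠ 0 := fun z hz h =>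
    (hball hz).2 (hinj i (hball hz).1.2 ha (sub_eq_zero.1 h))
  have hmax : ‖(F i b - F i a)⁻¹‖ ≤ (m / 2)⁻¹ := by
    refine Complex.norm_le_of_forall_mem_frontier_norm_le (U := ball b r)
      (f := fun z => (F i z - F i a)⁻¹) isBounded_ball ?_ ?_ (subset_closure (mem_ball_self hr))
    · have hd : DiffContOnCl ℂ (fun z => F i z - F i a) (ball b r) :=
        ((hF i).sub_const _).diffContOnCl_ball fun z hz => (hball hz).1.2
      exact hd.inv fun z hz => hne' z (closure_ball_subset_closedBall hz)
    · intro z hz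
      rw [frontier_ball b hr.ne'] at hz
      rw [norm_inv]
      refine inv_anti₀ (by positivity) ?_
      have h1 := hi z (Or.inr (Or.inr hz))
      have h2 := hmf z hz
      rw [dist_eq_norm] at h1 hia
      have h3 : ‖f z - f a‖ ≤ ‖f z - F i z‖ + ‖F i z - F i a‖ + ‖f a - F i a‖ := by
        rw [norm_sub_rev (f a)]
        refine le_trans (le_of_eq ?_) norm_add₃_le
        congr 1
        ring
      linarith
  rw [norm_inv] at hmax
  have h1 := (inv_le_inv₀ (norm_pos_iff.2 (hne' b (mem_closedBall_self hr.le)))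
    (by positivity)).1 hmax
  rw [dist_eq_norm] at hia hib
  have h2 : ‖F i b - F i a‖ ≤ ‖f b - F i b‖ + ‖f a - F i a‖ := by
    rw [norm_sub_rev (f b)]
    refine le_trans (le_of_eq ?_) (norm_add_le _ _)
    congr 1
    rw [hab]
    ring
  linarith

namespace IsDiscInjection

variable {D : Set ℂ} {p : ℂ} {f : ℂ → ℂ}

/-- Koebe's square root trick. -/
lemma exists_norm_deriv_lt (hf : IsDiscInjection D p f) (hD : IsOpen D) (hp : p ∈ D)
    (hlog : ∀ h : ℂ → ℂ, DifferentiableOn ℂ h D → (∀ z ∈ D, h z ≠ 0) → HasLogOn h D)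
    (hf' : deriv f p ≠ 0) {w : ℂ} (hw : ‖w‖ < 1) (hwf : w ∉ f '' D) :
    ∃ g, IsDiscInjection D p g ∧ ‖deriv f p‖ < ‖deriv g p‖ := by
  have hfd : ∀ z ∈ D, HasDerivAt f (deriv f z) z := fun z hz =>
    (hf.differentiableOn.differentiableAt (hD.mem_nhds hz)).hasDerivAt
  set h : ℂ → ℂ := fun z => discAut w (f z) with hh
  have hhd : ∀ z ∈ D, HasDerivAt h
      ((1 - (starRingEnd ℂ) w * w) / (1 - (starRingEnd ℂ) w * f z) ^ 2 * deriv f z) z := fun z hz =>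
    (hasDerivAt_discAut hw (hf.norm_lt z hz)).comp z (hfd z hz)
  have hhD : DifferentiableOn ℂ h D := fun z hz =>
    (hhd z hz).differentiableAt.differentiableWithinAt
  obtain ⟨L, hL, hLh⟩ := (hlog h hhD fun z hz h0 => hwf
    ⟨z, hz, (discAut_eq_zero_iff hw (hf.norm_lt z hz)).1 h0⟩).exists_differentiableOn hD hhD
  set s : ℂ → ℂ := fun z => Complex.exp (L z / 2) with hs
  have hsh : ∀ z ∈ D, s z ^ 2 = h z := by
    intro z hz
    rw [← hLh z hz, hs, ← Complex.exp_nat_mul]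
    congr 1
    push_cast
    ring
  have hsD : DifferentiableOn ℂ s D := (hL.div_const 2).cexp
  have hs1 : ∀ z ∈ D, ‖s z‖ < 1 := by
    intro z hz
    have h1 := norm_discAut_lt_one hw (hf.norm_lt z hz)
    change ‖h z‖ < 1 at h1
    rw [← hsh z hz, norm_pow] at h1
    exact (pow_lt_one_iff_of_nonneg (norm_nonneg _) two_ne_zero).1 h1
  have hsinj : InjOn s D := fun a ha b hb hab => by
    have h1 : h a = h b := by rw [← hsh a ha, ← hsh b hb, hab]
    exact hf.injOn ha hb (discAut_injOn hw (hf.norm_lt a ha) (hf.norm_lt b hb) h1)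
  set c := s p with hc
  have hc1 : ‖c‖ < 1 := hs1 p hp
  have hsd : HasDerivAt s (deriv s p) p :=
    (hsD.differentiableAt (hD.mem_nhds hp)).hasDerivAt
  have hgd : ∀ z ∈ D, HasDerivAt (fun z => discAut c (s z))
      ((1 - (starRingEnd ℂ) c * c) / (1 - (starRingEnd ℂ) c * s z) ^ 2 * deriv s z) z := fun z hz =>
    (hasDerivAt_discAut hc1 (hs1 z hz)).comp z
      (hsD.differentiableAt (hD.mem_nhds hz)).hasDerivAt
  refine ⟨fun z => discAut c (s z), ⟨fun z hz => (hgd z hz).differentiableAt.differentiableWithinAt,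
    fun a ha b hb hab => hsinj ha hb (discAut_injOn hc1 (hs1 a ha) (hs1 b hb) hab),
    fun z hz => norm_discAut_lt_one hc1 (hs1 z hz), discAut_self⟩, ?_⟩
  rw [(hgd p hp).deriv, ← hc]
  have hpow : HasDerivAt h (2 * c * deriv s p) p := by
    refine ((hsd.pow 2).congr_of_eventuallyEq ?_).congr_deriv ?_
    · filter_upwards [hD.mem_nhds hp] with z hz using (hsh z hz).symm
    · simp [hc]
  have hc2 : c ^ 2 = -w := by
    rw [hc, hsh p hp, hh]
    simp [discAut, hf.map_base]
  have hcw : ‖w‖ = ‖c‖ ^ 2 := by rw [← norm_pow, hc2, norm_neg]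
  have hself : ∀ u : ℂ, ‖u‖ < 1 → ‖1 - (starRingEnd ℂ) u * u‖ = 1 - ‖u‖ ^ 2 := by
    intro u hu
    rw [mul_comm, Complex.mul_conj, Complex.normSq_eq_norm_sq, ← Complex.ofReal_one,
      ← Complex.ofReal_sub, Complex.norm_real, Real.norm_of_nonneg]
    nlinarith [norm_nonneg u]
  have h1 := congrArg norm ((hhd p hp).unique hpow)
  rw [hf.map_base, mul_zero, sub_zero, one_pow, div_one, norm_mul, hself w hw, norm_mul, norm_mul,
    hcw, RCLike.norm_ofNat] at h1
  rw [norm_mul, norm_div, norm_pow, hself c hc1]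
  have ht0 : 0 < ‖c‖ := norm_pos_iff.2 (Complex.exp_ne_zero _)
  have hF : 0 < ‖deriv f p‖ := norm_pos_iff.2 hf'
  have hden : 0 < 1 - ‖c‖ ^ 2 := by nlinarith
  have h2 : ‖deriv s p‖ = (1 - (‖c‖ ^ 2) ^ 2) * ‖deriv f p‖ / (2 * ‖c‖) := by
    rw [h1]
    field_simp
  have h3 : (1 - ‖c‖ ^ 2) / (1 - ‖c‖ ^ 2) ^ 2 * ‖deriv s p‖ =
      (1 + ‖c‖ ^ 2) / (2 * ‖c‖) * ‖deriv f p‖ := by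
    rw [h2]
    field_simp
    ring
  rw [h3]
  refine lt_mul_of_one_lt_left hF ?_
  rw [one_lt_div (by positivity)]
  nlinarith [sq_pos_of_pos (sub_pos.2 hc1)]

/-- The extremal problem has a solution. -/
lemma exists_forall_norm_deriv_le (hf : IsDiscInjection D p f) (hD : IsOpen D)
    (hDc : IsPreconnected D) (hp : p ∈ D) (hf' : deriv f p ≠ 0) :
    ∃ g, IsDiscInjection D p g ∧ deriv g p ≠ 0 ∧
      ∀ h, IsDiscInjection D p h → ‖deriv h p‖ ≤ ‖deriv g p‖ := by
  set S : Set ℝ := {x | ∃ h, IsDiscInjection D p h ∧ ‖deriv h p‖ = x} with hS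
  have hSne : S.Nonempty := ⟨_, f, hf, rfl⟩
  obtain ⟨r, hr, hball⟩ := Metric.isOpen_iff.1 hD p hp
  have hSb : BddAbove S := by
    refine ⟨1 / r, ?_⟩
    rintro _ ⟨h, hh, rfl⟩
    refine Complex.norm_deriv_le_div_of_mapsTo_ball (hh.differentiableOn.mono hball)
      (fun z hz => ?_) hr
    rw [hh.map_base, mem_closedBall, dist_zero_right]
    exact (hh.norm_lt z (hball hz)).le
  obtain ⟨u, -, hu, huS⟩ := exists_seq_tendsto_sSup hSne hSb
  choose F hF hFu using huS
  obtain ⟨g, hg⟩ := exists_tendstoLocallyUniformlyOn (hyperfilter ℕ) hD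
    (fun n => (hF n).differentiableOn) fun n z hz => ((hF n).norm_lt z hz).le
  have hFd : ∀ᶠ n in (hyperfilter ℕ : Filter ℕ), DifferentiableOn ℂ (F n) D :=
    Eventually.of_forall fun n => (hF n).differentiableOn
  have hgd : DifferentiableOn ℂ g D := hg.differentiableOn hFd hD
  have hderiv : ‖deriv g p‖ = sSup S := by
    refine tendsto_nhds_unique ((hg.deriv hFd hD).tendsto_at hp).norm ?_
    simp only [Function.comp_apply, hFu]
    exact hu.mono_left Nat.hyperfilter_le_atTop
  have hgp : g p = 0 := by
    refine tendsto_nhds_unique (hg.tendsto_at hp) ?_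
    simp only [(hF _).map_base]
    exact tendsto_const_nhds
  have hmax : ∀ h, IsDiscInjection D p h → ‖deriv h p‖ ≤ ‖deriv g p‖ := fun h hh =>
    hderiv ▸ le_csSup hSb ⟨h, hh, rfl⟩
  have hg0 : deriv g p ≠ 0 := norm_pos_iff.1 ((norm_pos_iff.2 hf').trans_le (hmax f hf))
  have hle : ∀ z ∈ D, ‖g z‖ ≤ 1 := fun z hz =>
    le_of_tendsto (hg.tendsto_at hz).norm (Eventually.of_forall fun n => ((hF n).norm_lt z hz).le)
  refine ⟨g, ⟨hgd, ?_, fun z hz => (hle z hz).lt_of_ne fun h1 => ?_, hgp⟩, hg0, hmax⟩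
  · refine injOn_of_tendstoLocallyUniformlyOn hD hDc (fun n => (hF n).differentiableOn)
      (fun n => (hF n).injOn) hg ?_
    rintro ⟨c, hc⟩
    refine hg0 ?_
    have : g =ᶠ[𝓝 p] fun _ => c := by filter_upwards [hD.mem_nhds hp] with z hz using hc z hz
    rw [this.deriv_eq, deriv_const]
  · have := Complex.norm_eqOn_of_isPreconnected_of_isMaxOn hDc hD hgd hz
      (fun x hx => by simpa [h1] using hle x hx) hp
    simp [hgp, h1] at this

end IsDiscInjection

/-- The Riemann mapping theorem, for a bounded domain on which holomorphic nonvanishing functions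
have logarithms. -/
theorem nonempty_homeomorph_ball {D : Set ℂ} (hD : IsOpen D) (hDb : Bornology.IsBounded D)
    (hDc : IsConnected D)
    (hlog : ∀ h : ℂ → ℂ, DifferentiableOn ℂ h D → (∀ z ∈ D, h z ≠ 0) → HasLogOn h D) :
    Nonempty (D ≃ₜ ball (0 : ℂ) 1) := by
  obtain ⟨p, hp⟩ := hDc.nonempty
  obtain ⟨R, hR0, hR⟩ := hDb.subset_ball_lt 0 p
  have hR0' : (R : ℂ) ≠ 0 := Complex.ofReal_ne_zero.2 hR0.ne'
  have hd : ∀ z, HasDerivAt (fun z => (z - p) / (R : ℂ)) (1 / (R : ℂ)) z := fun z =>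
    ((hasDerivAt_id z).sub_const p).div_const _
  have hstart : IsDiscInjection D p fun z => (z - p) / (R : ℂ) := by
    refine ⟨fun z _ => (hd z).differentiableAt.differentiableWithinAt, fun a _ b _ hab => ?_,
      fun z hz => ?_, by simp⟩
    · simpa [hR0'] using hab
    · rw [norm_div, Complex.norm_real, Real.norm_of_nonneg hR0.le, div_lt_one hR0, ← dist_eq_norm]
      exact hR hz
  obtain ⟨f, hf, hf', hmax⟩ := hstart.exists_forall_norm_deriv_le hD hDc.isPreconnected hp
    (by rw [(hd p).deriv]; exact one_div_ne_zero hR0')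
  have hsurj : ∀ w ∈ ball (0 : ℂ) 1, w ∈ f '' D := by
    intro w hw
    by_contra hwf
    obtain ⟨g, hg, hlt⟩ := hf.exists_norm_deriv_lt hD hp hlog hf' (by simpa using hw) hwf
    exact (hmax g hg).not_gt hlt
  have hmaps : MapsTo f D (ball 0 1) := fun z hz => by simpa using hf.norm_lt z hz
  have hopen : ∀ s ⊆ D, IsOpen s → IsOpen (f '' s) := by
    refine ((hf.differentiableOn.analyticOnNhd hD).is_constant_or_isOpen
      hDc.isPreconnected).resolve_left ?_
    rintro ⟨c, hc⟩
    refine hf' ?_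
    have : f =ᶠ[𝓝 p] fun _ => c := by filter_upwards [hD.mem_nhds hp] with z hz using hc z hz
    rw [this.deriv_eq, deriv_const]
  have hbij : Function.Bijective (hmaps.restrict f D _) := by
    refine ⟨hmaps.restrict_inj.2 hf.injOn, ?_⟩
    rintro ⟨w, hw⟩
    obtain ⟨z, hz, rfl⟩ := hsurj w hw
    exact ⟨⟨z, hz⟩, rfl⟩
  refine ⟨(Equiv.ofBijective _ hbij).toHomeomorphOfContinuousOpen
    (hf.differentiableOn.continuousOn.mapsToRestrict hmaps) fun s hs => ?_⟩
  convert (hopen _ (Subtype.coe_image_subset D s) (hD.isOpenMap_subtype_val s hs)).preimage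
    (continuous_subtype_val : Continuous (Subtype.val : ball (0 : ℂ) 1 → ℂ)) using 1
  ext ⟨w, hw⟩
  simp [Subtype.ext_iff]

/-- The interior of a Jordan curve is homeomorphic to a disc. -/
theorem IsJordanParam.exists_jordan_components_homeomorph {γ : ℝ → ℂ} (hγ : IsJordanParam γ) :
    ∃ D E : Set ℂ, IsOpen D ∧ IsConnected D ∧ IsConnected E ∧ Bornology.IsBounded D ∧
      Disjoint D E ∧ D ∪ E = (range γ)ᶜ ∧ frontier D = range γ ∧
      Nonempty (D ≃ₜ ball (0 : ℂ) 1) := by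
  obtain ⟨D, E, hD, hE, hDc, hEc, hDb, -, hdisj, hunion, hfD, hfE⟩ := hγ.exists_jordan_components
  refine ⟨D, E, hD, hDc, hEc, hDb, hdisj, hunion, hfD, ?_⟩
  have hcl : Dᶜ = closure E := by
    rw [closure_eq_self_union_frontier, hfE]
    ext z
    have h := Set.ext_iff.1 hunion z
    have h' : z ∈ D → z ∉ E := fun hz => disjoint_left.1 hdisj hz
    have h'' : z ∈ D → z ∉ frontier D := fun hz hz' => by
      rw [hD.frontier_eq] at hz'
      exact hz'.2 hz
    rw [hfD] at h''
    simp only [mem_union, mem_compl_iff] at h ⊢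
    tauto
  exact nonempty_homeomorph_ball hD hDb hDc fun h hh h0 =>
    hasLogOn_of_isPreconnected_compl hD hDb hDc (hcl ▸ hEc.isPreconnected.closure) hh h0

/-- The sphere minus a point is a plane. -/
lemma exists_isOpenEmbedding_sphere (p : Sphere2) :
    ∃ φ : ℂ → Sphere2, IsOpenEmbedding φ ∧ range φ = {p}ᶜ := by
  have : Fact (Module.finrank ℝ (EuclideanSpace ℝ (Fin 3)) = 2 + 1) := ⟨by simp⟩
  let e := (stereographic' 2 p).symm
  have hs : e.source = univ := by simp [e]
  refine ⟨e ∘ Complex.orthonormalBasisOneI.repr.toHomeomorph,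
    (e.isOpenEmbedding hs).comp (Homeomorph.isOpenEmbedding _), ?_⟩
  rw [EquivLike.range_comp, ← image_univ, ← hs, e.image_source_eq_target]
  simp [e]

lemma nonempty_homeomorph_circle2 : Nonempty (Circle ≃ₜ Circle2) := by
  have h : IsEmbedding ((↑) : Circle → ℂ) := .subtypeVal
  have hr : Complex.orthonormalBasisOneI.repr '' range ((↑) : Circle → ℂ) = Circle2 := by
    have : range ((↑) : Circle → ℂ) = sphere 0 1 := by
      ext z
      exact ⟨by rintro ⟨w, rfl⟩; exact w.2, fun hz => ⟨⟨z, hz⟩, rfl⟩⟩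
    rw [this]
    simp
  exact ⟨(h.toHomeomorph.trans (Complex.orthonormalBasisOneI.repr.toHomeomorph.image _)).trans
    (Homeomorph.setCongr hr)⟩

lemma exists_param_circle2 : ∃ c : ℝ → Circle2, Continuous c ∧ Function.Surjective c ∧
    Function.Periodic c 1 ∧ ∀ s t, c s = c t → ∃ n : ℤ, t = s + n := by
  obtain ⟨e⟩ := nonempty_homeomorph_circle2
  let a : AddCircle (1 : ℝ) ≃ₜ Circle2 := (AddCircle.homeomorphCircle one_ne_zero).trans e
  refine ⟨fun t => a t, a.continuous.comp (AddCircle.continuous_mk' 1),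
    a.surjective.comp QuotientAddGroup.mk_surjective, fun t => by simp,
    fun s t hst => ?_⟩
  obtain ⟨n, hn⟩ := (QuotientAddGroup.eq_iff_sub_mem.1 (a.injective hst).symm)
  exact ⟨n, by simp at hn; linarith⟩

/-- The circle and the sphere are not homeomorphic. -/
lemma IsSimpleClosedCurve.ne_univ {C : Set Sphere2} (hC : IsSimpleClosedCurve C) : C ≠ univ := by
  rintro rfl
  obtain ⟨e⟩ := hC
  obtain ⟨e'⟩ := nonempty_homeomorph_circle2
  let h : Circle ≃ₜ Sphere2 := (e'.trans e.symm).trans (Homeomorph.Set.univ _)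
  have h1 : (1 : Circle) ≠ -1 := (Circle.neg_ne_self 1).symm
  obtain ⟨φ, hφ, hφr⟩ := exists_isOpenEmbedding_sphere (h 1)
  obtain ⟨z, hz⟩ : h (-1) ∈ range φ := by
    rw [hφr]
    exact fun h' => h1 (h.injective h').symm
  refine Circle.not_isPreconnected_compl_pair h1 ?_
  have h2 : h.symm '' (φ '' {z}ᶜ) = {1, -1}ᶜ := by
    rw [image_compl_eq_range_sdiff_image hφ.injective, hφr, image_singleton, hz]
    ext x
    rw [h.image_symm]
    simp [not_or]
  rw [← h2]
  exact (((isConnected_compl_singleton_of_one_lt_rank (by simp) z).isPreconnected).image _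
    hφ.continuous.continuousOn).image _ h.symm.continuous.continuousOn

/-- The component of the complement of a simple closed curve in the sphere not containing `p`. -/
lemma IsSimpleClosedCurve.exists_components {C : Set Sphere2} (hC : IsSimpleClosedCurve C)
    {p : Sphere2} (hp : p ∉ C) :
    ∃ U V : Set Sphere2, IsOpen U ∧ IsOpen V ∧ IsConnected U ∧ IsConnected V ∧ Disjoint U V ∧
      U ∪ V = Cᶜ ∧ p ∈ V ∧ Nonempty (U ≃ₜ OpenDisk) ∧ frontier U = C := by
  obtain ⟨e⟩ := hC
  obtain ⟨φ, hφ, hφr⟩ := exists_isOpenEmbedding_sphere p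
  obtain ⟨c, hc, hcs, hcp, hci⟩ := exists_param_circle2
  have hmem : ∀ t, (e.symm (c t) : Sphere2) ∈ range φ := fun t => by
    rw [hφr]
    exact fun h => hp (mem_singleton_iff.1 h ▸ (e.symm (c t)).2)
  choose γ hγ using hmem
  have hφp : ∀ z, φ z ≠ p := fun z => hφr.subset (mem_range_self z)
  have hγJ : IsJordanParam γ := by
    refine ⟨hφ.isEmbedding.continuous_iff.2 ?_, fun t => hφ.injective ?_, fun s t hst => hci s t ?_⟩
    · simpa only [Function.comp_def, hγ] using
        continuous_subtype_val.comp (e.symm.continuous.comp hc)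
    · rw [hγ, hγ, hcp]
    · refine e.symm.injective (Subtype.ext ?_)
      rw [← hγ, ← hγ, hst]
  have hγC : φ '' range γ = C := by
    rw [← range_comp]
    ext x
    simp only [mem_range, Function.comp_apply, hγ]
    refine ⟨fun ⟨t, ht⟩ => ht ▸ (e.symm (c t)).2, fun hx => ?_⟩
    obtain ⟨t, ht⟩ := hcs (e ⟨x, hx⟩)
    exact ⟨t, by rw [ht, e.symm_apply_apply]⟩
  obtain ⟨D, E, hD, hDc, hEc, hDb, hdisj, hunion, hfD, ⟨h⟩⟩ :=
    hγJ.exists_jordan_components_homeomorph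
  have hclD : closure (φ '' D) = φ '' closure D :=
    (closure_minimal (image_mono subset_closure)
      (hDb.isCompact_closure.image hφ.continuous).isClosed).antisymm
      (image_closure_subset_closure_image hφ.continuous)
  have hfr : frontier (φ '' D) = C := by
    rw [(hφ.isOpenMap D hD).frontier_eq, hclD, ← image_sdiff hφ.injective, ← hD.frontier_eq, hfD,
      hγC]
  have hV : insert p (φ '' E) = (closure (φ '' D))ᶜ := by
    rw [hclD, closure_eq_self_union_frontier, hfD]
    ext x
    by_cases hx : x = p
    · subst hx
      simp [hφp]
    · obtain ⟨z, rfl⟩ := hφr.superset hx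
      have h := Set.ext_iff.1 hunion z
      have h' : z ∈ D → z ∉ E := fun hz => disjoint_left.1 hdisj hz
      simp only [mem_insert_iff, hx, false_or, mem_compl_iff, hφ.injective.mem_set_image,
        mem_union] at h ⊢
      tauto
  have hVo : IsOpen (insert p (φ '' E)) := hV ▸ isClosed_closure.isOpen_compl
  have hpE : p ∈ closure (φ '' E) := by
    by_contra hpE
    have : IsOpen {p} := by
      convert hVo.inter (isClosed_closure (s := φ '' E)).isOpen_compl using 1
      ext x
      refine ⟨?_, fun ⟨h1, h2⟩ => h1.resolve_right fun h => h2 (subset_closure h)⟩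
      rintro rfl
      exact ⟨mem_insert _ _, hpE⟩
    have h1 : IsClosedEmbedding φ := ⟨hφ.isEmbedding, hφr ▸ this.isClosed_compl⟩
    exact not_compactSpace_iff.2 (inferInstance : NoncompactSpace ℂ) h1.compactSpace
  refine ⟨φ '' D, insert p (φ '' E), hφ.isOpenMap D hD, hVo, hDc.image _ hφ.continuous.continuousOn,
    ⟨insert_nonempty _ _, (hEc.isPreconnected.image _ hφ.continuous.continuousOn).subset_closure
      (subset_insert _ _) (insert_subset hpE subset_closure)⟩, ?_, ?_, mem_insert _ _, ?_, hfr⟩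
  · rw [hV, disjoint_compl_right_iff_subset]
    exact subset_closure
  · rw [hV, ← hfr, (hφ.isOpenMap D hD).frontier_eq]
    ext x
    have := subset_closure (s := φ '' D) (a := x)
    by_cases hx : x ∈ φ '' D
    · simp [hx]
    · simp [hx]
  · refine ⟨((hφ.isEmbedding.homeomorphImage D).symm.trans h).trans ?_⟩
    exact (Complex.orthonormalBasisOneI.repr.toHomeomorph.image _).trans
      (Homeomorph.setCongr (by simp))

end JordanSchoenflies

/-- **Jordan–Schoenflies on the sphere.** For any subset `C ⊆ S²`
homeomorphic to the circle, `S² \ C` has exactly two connected components, each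
homeomorphic to the open unit disk, and each with frontier `C`. -/
theorem jordan_schoenflies_sphere
    (C : Set Sphere2) (hC : IsSimpleClosedCurve C) :
    ∃ U V : Set Sphere2,
      IsOpen U ∧ IsOpen V ∧ IsConnected U ∧ IsConnected V ∧
      Disjoint U V ∧ U ∪ V = Cᶜ ∧
      Nonempty (U ≃ₜ OpenDisk) ∧ Nonempty (V ≃ₜ OpenDisk) ∧
      frontier U = C ∧ frontier V = C := by
  obtain ⟨p, hp⟩ := (Set.ne_univ_iff_exists_notMem C).1 hC.ne_univ
  obtain ⟨U, V, hU, hV, hUc, hVc, hUV, hun, -, hUd, hUf⟩ := hC.exists_components hp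
  obtain ⟨q, hq⟩ := hUc.nonempty
  have hqC : q ∉ C := hun.subset (Or.inl hq)
  obtain ⟨U', V', hU', hV', hUc', hVc', hUV', hun', hqV', hUd', hUf'⟩ :=
    hC.exists_components hqC
  have h1 : V' ⊆ U := hVc'.isPreconnected.subset_left_of_subset_union hU hV hUV
    (hun ▸ hun' ▸ Set.subset_union_right) ⟨q, hqV', hq⟩
  have h2 : U ⊆ V' := hUc.isPreconnected.subset_right_of_subset_union hU' hV' hUV'
    (hun' ▸ hun ▸ Set.subset_union_left) ⟨q, hq, hqV'⟩
  obtain rfl := h1.antisymm h2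
  exact ⟨V', U', hV', hU', hVc', hUc', hUV'.symm, by rw [Set.union_comm, hun'], hUd, hUd', hUf,
    hUf'⟩
end
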